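/- arXiv:1206.1269 — 2 statements merged into one kernel-verified Lean document; each statement's English description precedes it below -/
import Mathlib

section
/- The graph D_8 is d_1-choosable, where D_8 has vertices w, x_1, x_2, x_3, x_4, x_5, y_3, y_4 with edges: x_1x_2x_3x_4x_5x_1 a 5-cycle, w adjacent to x_1, x_2, x_3, x_4, x_5, y_3 adjacent to x_2, x_3, x_4 and w, and y_4 adjacent to x_3, x_4, x_5 and w, and y_3 not adjacent to y_4. -/
/-- Degree via the cardinality of the neighbor set. -/
noncomputable def deg {α : Type*} (G : SimpleGraph α) (v : α) : ℕ :=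
  (G.neighborSet v).ncard

/-- The graph `D_8`: vertex `0` is `w`, vertices `1,…,5` are `x_1,…,x_5` forming a
5-cycle, vertex `6` is `y_3` (adjacent to `x_2,x_3,x_4,w`), vertex `7` is `y_4`
(adjacent to `x_3,x_4,x_5,w`); `w` is adjacent to all `x_i`; `y_3` is not adjacent
to `y_4`. -/
def D8 : SimpleGraph (Fin 8) :=
  SimpleGraph.fromRel (fun u v => (u, v) ∈
    [((1 : Fin 8), (2 : Fin 8)), (2,3), (3,4), (4,5), (5,1),
     (0,1), (0,2), (0,3), (0,4), (0,5),
     (6,2), (6,3), (6,4), (6,0),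
     (7,3), (7,4), (7,5), (7,0)])

open MvPolynomial in
/-- The product of `X u - X v` over a list of edges `(u, v)`. -/
noncomputable def edgePoly {σ : Type*} (l : List (σ × σ)) : MvPolynomial σ ℤ :=
  (l.map fun e => X e.1 - X e.2).prod

/-- The coefficient of the monomial with exponents `t` in `edgePoly l`, computed by expanding
one factor at a time. -/
def edgeCoeff {σ : Type*} [Fintype σ] [DecidableEq σ] : List (σ × σ) → (σ → ℕ) → ℤ
  | [], t => if ∀ i, t i = 0 then 1 else 0
  | e :: l, t =>
      (if t e.1 = 0 then 0 else edgeCoeff l (Function.update t e.1 (t e.1 - 1))) -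
      (if t e.2 = 0 then 0 else edgeCoeff l (Function.update t e.2 (t e.2 - 1)))

theorem coeff_X_mul_equivFunOnFinite {σ : Type*} [Fintype σ] [DecidableEq σ] (u : σ) (t : σ → ℕ)
    (p : MvPolynomial σ ℤ) :
    (MvPolynomial.X u * p).coeff (Finsupp.equivFunOnFinite.symm t) =
      if t u = 0 then 0
      else p.coeff (Finsupp.equivFunOnFinite.symm (Function.update t u (t u - 1))) := by
  have h : Finsupp.equivFunOnFinite.symm t - Finsupp.single u 1 =
      Finsupp.equivFunOnFinite.symm (Function.update t u (t u - 1)) := by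
    ext i
    by_cases hi : i = u
    · subst hi
      simp
    · simp [Function.update_of_ne hi, Finsupp.single_eq_of_ne hi]
  rw [MvPolynomial.coeff_X_mul', h]
  by_cases hu : t u = 0 <;> simp [hu]

theorem coeff_edgePoly {σ : Type*} [Fintype σ] [DecidableEq σ] (l : List (σ × σ)) (t : σ → ℕ) :
    (edgePoly l).coeff (Finsupp.equivFunOnFinite.symm t) = edgeCoeff l t := by
  induction l generalizing t with
  | nil =>
    simp only [edgePoly, edgeCoeff, List.map_nil, List.prod_nil, MvPolynomial.coeff_one]
    refine if_congr ?_ rfl rfl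
    rw [eq_comm, DFunLike.ext_iff]
    rfl
  | cons e l ih =>
    have h : edgePoly (e :: l) = MvPolynomial.X e.1 * edgePoly l -
        MvPolynomial.X e.2 * edgePoly l := by
      simp [edgePoly, sub_mul]
    rw [h, MvPolynomial.coeff_sub, coeff_X_mul_equivFunOnFinite, coeff_X_mul_equivFunOnFinite,
      ih, ih, edgeCoeff]

theorem totalDegree_edgePoly_le {σ : Type*} (l : List (σ × σ)) :
    (edgePoly l).totalDegree ≤ l.length := by
  induction l with
  | nil => simp [edgePoly]
  | cons e l ih =>
    have h : (MvPolynomial.X e.1 - MvPolynomial.X e.2 : MvPolynomial σ ℤ).totalDegree ≤ 1 :=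
      (MvPolynomial.totalDegree_sub _ _).trans (by simp)
    have h' := MvPolynomial.totalDegree_mul
      (MvPolynomial.X e.1 - MvPolynomial.X e.2 : MvPolynomial σ ℤ) (edgePoly l)
    have he : edgePoly (e :: l) = (MvPolynomial.X e.1 - MvPolynomial.X e.2) * edgePoly l := by
      simp [edgePoly]
    rw [he, List.length_cons]
    omega

/-- The Alon–Tarsi criterion for a list of edges: a nonzero top-degree coefficient whose
exponents are smaller than the list sizes yields a proper coloring from the lists. -/
theorem exists_list_coloring_of_edgeCoeff_ne_zero {σ : Type*} [Fintype σ] [DecidableEq σ]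
    (l : List (σ × σ)) (t : σ → ℕ) (hc : edgeCoeff l t ≠ 0) (ht : ∑ i, t i = l.length)
    (L : σ → Finset ℕ) (hL : ∀ i, t i < (L i).card) :
    ∃ c : σ → ℕ, (∀ v, c v ∈ L v) ∧ ∀ e ∈ l, c e.1 ≠ c e.2 := by
  rw [← coeff_edgePoly] at hc
  have hdeg : (Finsupp.equivFunOnFinite.symm t).degree = l.length := by
    rw [Finsupp.degree_eq_sum, ← ht]
    rfl
  have htot : (edgePoly l).totalDegree = (Finsupp.equivFunOnFinite.symm t).degree := by
    refine le_antisymm (hdeg ▸ totalDegree_edgePoly_le l) ?_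
    exact MvPolynomial.le_totalDegree (MvPolynomial.mem_support_iff.mpr hc)
  obtain ⟨s, hs, hne⟩ := MvPolynomial.combinatorial_nullstellensatz_exists_eval_nonzero
    (edgePoly l) _ hc htot (fun i => (L i).map Nat.castEmbedding)
    (fun i => by simpa using hL i)
  simp only [Finset.mem_map, Nat.castEmbedding_apply] at hs
  choose c hcL hcs using hs
  refine ⟨c, hcL, fun e he hec => hne ?_⟩
  rw [edgePoly, map_list_prod, List.prod_eq_zero_iff]
  simp only [List.map_map, List.mem_map]
  exact ⟨e, he, by simp [← hcs, hec]⟩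

instance : DecidableRel D8.Adj := fun u v => by
  unfold D8
  infer_instance

theorem deg_eq_degree {α : Type*} [Fintype α] (G : SimpleGraph α) [DecidableRel G.Adj] (v : α) :
    deg G v = G.degree v := by
  rw [deg, Set.ncard_eq_toFinset_card', ← SimpleGraph.card_neighborFinset_eq_degree]
  rfl

/-- `D_8` is `d_1`-choosable. -/
theorem stmt4 (L : Fin 8 → Finset ℕ) (hL : ∀ v, deg D8 v - 1 ≤ (L v).card) :
    ∃ c : Fin 8 → ℕ, (∀ v, c v ∈ L v) ∧ ∀ u v, D8.Adj u v → c u ≠ c v := by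
  have hlt : ∀ v, (![4, 1, 2, 2, 3, 2, 2, 2] : Fin 8 → ℕ) v < D8.degree v - 1 := by
    decide +kernel
  obtain ⟨c, hcL, hc⟩ := exists_list_coloring_of_edgeCoeff_ne_zero
    [((1 : Fin 8), (2 : Fin 8)), (2,3), (3,4), (4,5), (5,1),
     (0,1), (0,2), (0,3), (0,4), (0,5),
     (6,2), (6,3), (6,4), (6,0),
     (7,3), (7,4), (7,5), (7,0)]
    ![4, 1, 2, 2, 3, 2, 2, 2] (by decide +kernel) (by decide) L
    (fun v => (hlt v).trans_le (deg_eq_degree D8 v ▸ hL v))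
  refine ⟨c, hcL, fun u v huv => ?_⟩
  rcases ((SimpleGraph.fromRel_adj _ _ _).mp huv).2 with h | h
  · exact hc (u, v) h
  · exact (hc (v, u) h).symm
end

section
/- Every circular interval graph G with list chromatic number χ_ℓ(G) ≥ Δ(G) ≥ 9 contains a clique on Δ(G) vertices. -/
/-- Maximum degree. -/
noncomputable def maxDeg {α : Type*} (G : SimpleGraph α) : ℕ :=
  sSup (Set.range (deg G))

/-- A list assignment `L` is good on `G` if there is a proper coloring from the lists. -/
def GoodList {V : Type*} (G : SimpleGraph V) (L : V → Finset ℕ) : Prop :=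
  ∃ c : V → ℕ, (∀ v, c v ∈ L v) ∧ ∀ u v, G.Adj u v → c u ≠ c v

/-- The list chromatic number (choice number): the least `k` such that `G` is
colorable from any lists of size at least `k`. -/
noncomputable def listChromNum {V : Type*} (G : SimpleGraph V) : ℕ :=
  sInf {k | ∀ L : V → Finset ℕ, (∀ v, k ≤ (L v).card) → GoodList G L}

/-- `G` is a circular interval graph: there is an injective placement `p` of the
vertices on the unit circle and a set `C` of closed arcs (each given by a starting
point and a length) such that distinct vertices are adjacent iff some arc contains
both. -/
def IsCircularInterval {V : Type*} (G : SimpleGraph V) : Prop :=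
  ∃ (p : V → AddCircle (1 : ℝ)) (C : Set (AddCircle (1 : ℝ) × ℝ)),
    Function.Injective p ∧
    ∀ u v, G.Adj u v ↔ u ≠ v ∧ ∃ j ∈ C,
      (∃ s : ℝ, 0 ≤ s ∧ s ≤ j.2 ∧ p u = j.1 + (s : AddCircle (1 : ℝ))) ∧
      (∃ s : ℝ, 0 ≤ s ∧ s ≤ j.2 ∧ p v = j.1 + (s : AddCircle (1 : ℝ)))

section ListColoring

variable {V : Type*} (G : SimpleGraph V)

open Classical in
/-- The neighbors of `v` inside the finite set `W`. -/
noncomputable def nbr (W : Finset V) (v : V) : Finset V := W.filter (G.Adj v)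

/-- The subgraph induced on `W` has a proper coloring from the lists `L`. -/
def ColorableOn (W : Finset V) (L : V → Finset ℕ) : Prop :=
  ∃ c : V → ℕ, (∀ v ∈ W, c v ∈ L v) ∧ ∀ u ∈ W, ∀ v ∈ W, G.Adj u v → c u ≠ c v

variable {G}

lemma mem_nbr {W : Finset V} {u v : V} : u ∈ nbr G W v ↔ u ∈ W ∧ G.Adj v u := by
  simp [nbr]

lemma nbr_mono {W X : Finset V} (h : X ⊆ W) (v : V) : nbr G X v ⊆ nbr G W v := by
  intro u hu
  rw [mem_nbr] at hu ⊢
  exact ⟨h hu.1, hu.2⟩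

lemma exists_common_color {X : Finset V} {L : V → Finset ℕ} {x y : V} (hx : x ∈ X) (hy : y ∈ X)
    (hpot : (X.biUnion L).card < X.card) (h : X.card ≤ (L x).card + (L y).card) :
    ∃ a, a ∈ L x ∧ a ∈ L y := by
  by_contra! hcon
  have hd : Disjoint (L x) (L y) := Finset.disjoint_left.2 hcon
  have hsub : L x ∪ L y ⊆ X.biUnion L :=
    Finset.union_subset (Finset.subset_biUnion_of_mem L hx) (Finset.subset_biUnion_of_mem L hy)
  have := Finset.card_le_card hsub
  rw [Finset.card_union_of_disjoint hd] at this
  omega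

/-- `W` is a minimal set that is not colorable from the `k`-element lists `L`; degrees in `W` are
at most `k + 1` and cliques have at most `k` vertices. -/
structure Critical (G : SimpleGraph V) (W : Finset V) (L : V → Finset ℕ) (k : ℕ) : Prop where
  eight_le : 8 ≤ k
  card_list : ∀ v, (L v).card = k
  not_colorable : ¬ ColorableOn G W L
  colorable : ∀ X ⊂ W, ColorableOn G X L
  nbr_le : ∀ v ∈ W, (nbr G W v).card ≤ k + 1
  clique_le : ∀ S ⊆ W, (∀ u ∈ S, ∀ v ∈ S, u ≠ v → G.Adj u v) → S.card ≤ k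

lemma Critical.exists_not_adj {W : Finset V} {L : V → Finset ℕ} {k : ℕ}
    (hC : Critical G W L k) {S : Finset V} (hS : S ⊆ W) (h : k < S.card) :
    ∃ u ∈ S, ∃ v ∈ S, u ≠ v ∧ ¬ G.Adj u v := by
  by_contra! hcon
  exact absurd (hC.clique_le S hS fun u hu v hv huv => hcon u hu v hv huv) (by omega)

variable [DecidableEq V]

lemma nbr_subset_erase (W : Finset V) (v : V) : nbr G W v ⊆ W.erase v := by
  intro u hu
  rw [mem_nbr] at hu
  exact Finset.mem_erase.2 ⟨hu.2.ne', hu.1⟩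

/-- A proper coloring of `P` extends to `W` when the rest is suitably degenerate. -/
lemma colorableOn_of_degenerate {L : V → Finset ℕ} (R : Finset V) :
    ∀ (P : Finset V) (c : V → ℕ), Disjoint P R → (∀ v ∈ P, c v ∈ L v) →
      (∀ u ∈ P, ∀ v ∈ P, G.Adj u v → c u ≠ c v) →
      (∀ U ⊆ R, U.Nonempty → ∃ u ∈ U,
        ((nbr G P u).image c ∩ L u).card + (nbr G U u).card < (L u).card) →
      ColorableOn G (P ∪ R) L := by
  intro P c hPR hcP hcadj hdeg
  suffices H : ∀ U ⊆ R, ∃ d : V → ℕ, (∀ v ∈ P, d v = c v) ∧ (∀ v ∈ U, d v ∈ L v) ∧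
      ∀ u ∈ P ∪ U, ∀ v ∈ P ∪ U, G.Adj u v → d u ≠ d v by
    obtain ⟨d, h1, h2, h3⟩ := H R subset_rfl
    refine ⟨d, fun v hv => ?_, h3⟩
    rcases Finset.mem_union.1 hv with hv | hv
    · rw [h1 v hv]; exact hcP v hv
    · exact h2 v hv
  intro U
  induction U using Finset.strongInduction with
  | H U ih =>
    intro hU
    rcases U.eq_empty_or_nonempty with rfl | hne
    · exact ⟨c, by simp, by simp, by simpa using hcadj⟩
    obtain ⟨u, huU, hu⟩ := hdeg U hU hne
    obtain ⟨d, h1, h2, h3⟩ := ih (U.erase u) (Finset.erase_ssubset huU)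
      ((Finset.erase_subset _ _).trans hU)
    have huP : u ∉ P := fun h => Finset.disjoint_left.1 hPR h (hU huU)
    obtain ⟨a, haL, ha⟩ : ∃ a ∈ L u, a ∉ ((nbr G P u).image c ∩ L u) ∪ (nbr G U u).image d := by
      have hlt : (((nbr G P u).image c ∩ L u) ∪ (nbr G U u).image d).card < (L u).card :=
        (Finset.card_union_le _ _).trans_lt
          ((Nat.add_le_add_left Finset.card_image_le _).trans_lt hu)
      exact Finset.exists_mem_notMem_of_card_lt_card hlt
    simp only [Finset.mem_union, Finset.mem_inter, Finset.mem_image, not_or, not_and,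
      not_exists] at ha
    have hau : ∀ v ∈ P ∪ U, G.Adj u v → d v ≠ a := by
      intro v hv huv hva
      rcases Finset.mem_union.1 hv with hv | hv
      · exact ha.1 ⟨v, mem_nbr.2 ⟨hv, huv⟩, by rw [← h1 v hv, hva]⟩ haL
      · exact ha.2 v (mem_nbr.2 ⟨hv, huv⟩) hva
    have hmem : ∀ v ∈ P ∪ U, v ≠ u → v ∈ P ∪ U.erase u := by
      intro v hv hvu
      simp only [Finset.mem_union, Finset.mem_erase] at hv ⊢
      tauto
    refine ⟨Function.update d u a, fun v hv => ?_, fun v hv => ?_, fun v hv w hw hvw => ?_⟩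
    · rw [Function.update_of_ne (by rintro rfl; exact huP hv)]
      exact h1 v hv
    · by_cases hvu : v = u
      · subst hvu; simpa using haL
      · rw [Function.update_of_ne hvu]
        exact h2 v (Finset.mem_erase.2 ⟨hvu, hv⟩)
    · by_cases hvu : v = u
      · subst hvu
        rw [Function.update_self, Function.update_of_ne hvw.ne']
        exact (hau w hw hvw).symm
      · by_cases hwu : w = u
        · subst hwu
          rw [Function.update_self, Function.update_of_ne hvu]
          exact hau v hv hvw.symm
        · rw [Function.update_of_ne hvu, Function.update_of_ne hwu]
          exact h3 v (hmem v hv hvu) w (hmem w hw hwu) hvw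

/-- The small pot principle: lists may be assumed to use fewer colors than there are vertices. -/
lemma colorableOn_of_small_pot {X : Finset V} {f : V → ℕ} (hf : ∀ v ∈ X, f v < X.card)
    (h : ∀ L : V → Finset ℕ, (∀ v ∈ X, (L v).card = f v) → (X.biUnion L).card < X.card →
      ColorableOn G X L)
    (L : V → Finset ℕ) (hL : ∀ v ∈ X, f v ≤ (L v).card) : ColorableOn G X L := by
  classical
  obtain ⟨S, hS, hmax, hSe⟩ : ∃ S ⊆ X, (∀ T ⊆ X, (T.card : ℤ) - ((T.biUnion L).card : ℤ) ≤
      (S.card : ℤ) - ((S.biUnion L).card : ℤ)) ∧ (S = ∅ ∨ (S.biUnion L).card < S.card) := by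
    obtain ⟨S, hS, hmax⟩ := Finset.exists_max_image X.powerset
      (fun S => (S.card : ℤ) - ((S.biUnion L).card : ℤ)) ⟨∅, by simp⟩
    simp only [Finset.mem_powerset] at hS hmax
    by_cases hdef : (S.biUnion L).card < S.card
    · exact ⟨S, hS, hmax, Or.inr hdef⟩
    · refine ⟨∅, by simp, fun T hT => ?_, Or.inl rfl⟩
      have := hmax T hT
      simp only [Finset.card_empty, Finset.biUnion_empty]
      push_cast
      omega
  have hall : ∀ T ⊆ X \ S, T.card ≤ (T.biUnion L \ S.biUnion L).card := by
    intro T hT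
    have hTX : T ⊆ X := hT.trans Finset.sdiff_subset
    have h1 := hmax (S ∪ T) (Finset.union_subset hS hTX)
    have hd : Disjoint S T := by
      rw [Finset.disjoint_left]
      intro v hv hv'
      exact (Finset.mem_sdiff.1 (hT hv')).2 hv
    have hbu : (S ∪ T).biUnion L = S.biUnion L ∪ (T.biUnion L \ S.biUnion L) := by
      rw [Finset.union_sdiff_self_eq_union, Finset.union_biUnion]
    rw [Finset.card_union_of_disjoint hd, hbu,
      Finset.card_union_of_disjoint Finset.disjoint_sdiff] at h1
    push_cast at h1
    omega
  obtain ⟨g, hginj, hg⟩ := (Finset.all_card_le_biUnion_card_iff_exists_injective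
    (fun v : {v // v ∈ X \ S} => L v \ S.biUnion L)).1 (by
      intro T
      have h1 := hall (T.map (Function.Embedding.subtype _)) (by
        intro v hv
        simp only [Finset.mem_map, Function.Embedding.coe_subtype] at hv
        obtain ⟨a, -, rfl⟩ := hv
        exact a.2)
      rw [Finset.card_map] at h1
      refine h1.trans (Finset.card_le_card ?_)
      intro a ha
      simp only [Finset.mem_sdiff, Finset.mem_biUnion, Finset.mem_map,
        Function.Embedding.coe_subtype] at ha ⊢
      obtain ⟨⟨v, ⟨w, hw, rfl⟩, hav⟩, h2⟩ := ha
      exact ⟨w, hw, hav, h2⟩)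
  have hcomb : ∀ c : V → ℕ, (∀ v ∈ S, c v ∈ L v) →
      (∀ u ∈ S, ∀ v ∈ S, G.Adj u v → c u ≠ c v) → ColorableOn G X L := by
    intro c hc1 hc2
    have hsd : ∀ v ∈ X, v ∉ S → v ∈ X \ S := fun v h1 h2 => Finset.mem_sdiff.2 ⟨h1, h2⟩
    have key : ∀ v (hv : v ∈ X \ S) w, w ∈ S → g ⟨v, hv⟩ ≠ c w := by
      intro v hv w hw heq
      exact (Finset.mem_sdiff.1 (hg ⟨v, hv⟩)).2
        (heq ▸ Finset.mem_biUnion.2 ⟨w, hw, hc1 w hw⟩)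
    refine ⟨fun v => if hv : v ∈ X \ S then g ⟨v, hv⟩ else c v, fun v hv => ?_,
      fun u hu v hv huv => ?_⟩
    · by_cases hvS : v ∈ S
      · simpa [hvS] using hc1 v hvS
      · simpa [hsd v hv hvS, hvS, hv] using (Finset.mem_sdiff.1 (hg ⟨v, hsd v hv hvS⟩)).1
    · by_cases huS : u ∈ S <;> by_cases hvS : v ∈ S
      · simpa [huS, hvS] using hc2 u huS v hvS huv
      · simpa [huS, hvS, hv] using (key v (hsd v hv hvS) u huS).symm
      · simpa [huS, hvS, hu] using key u (hsd u hu huS) v hvS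
      · have : g ⟨u, hsd u hu huS⟩ ≠ g ⟨v, hsd v hv hvS⟩ := by
          intro h
          exact huv.ne (by simpa using hginj h)
        simpa [huS, hvS, hu, hv] using this
  rcases hSe with rfl | hSe
  · exact hcomb (fun _ => 0) (by simp) (by simp)
  · have hSX := Finset.card_le_card hS
    obtain ⟨C, hC, hCcard⟩ := Infinite.exists_superset_card_eq (S.biUnion L) (X.card - 1) (by omega)
    have hsub : ∀ v, v ∈ X → ∃ B : Finset ℕ, B ⊆ (if v ∈ S then L v else C) ∧ B.card = f v := by
      intro v hv
      apply Finset.exists_subset_card_eq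
      split_ifs with hvS
      · exact hL v hv
      · have := hf v hv
        omega
    choose! B hB hBc using hsub
    obtain ⟨c, hc1, hc2⟩ := h B hBc (by
      have : X.biUnion B ⊆ C := by
        intro a ha
        obtain ⟨v, hv, hav⟩ := Finset.mem_biUnion.1 ha
        have := hB v hv hav
        split_ifs at this with hvS
        · exact hC (Finset.mem_biUnion.2 ⟨v, hvS, this⟩)
        · exact this
      have := Finset.card_le_card this
      omega)
    refine hcomb c (fun v hv => ?_) (fun u hu v hv => hc2 u (hS hu) v (hS hv))
    simpa [hv] using hB v (hS hv) (hc1 v (hS hv))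

lemma card_image_inter_lt {S : Finset V} {c : V → ℕ} {A : Finset ℕ} {x y : V} (hx : x ∈ S)
    (hy : y ∈ S) (hxy : x ≠ y) (h : c x = c y ∨ c x ∉ A ∨ c y ∉ A) :
    (S.image c ∩ A).card < S.card := by
  have aux : ∀ w ∈ S, S.image c ∩ A ⊆ (S.erase w).image c →
      (S.image c ∩ A).card < S.card := fun w hw hsub =>
    ((Finset.card_le_card hsub).trans Finset.card_image_le).trans_lt
      (Finset.card_erase_lt_of_mem hw)
  have sub : ∀ w, (∀ v ∈ S, c v ∈ A → v = w → ∃ u ∈ S, u ≠ w ∧ c u = c w) →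
      S.image c ∩ A ⊆ (S.erase w).image c := by
    intro w hw b hb
    simp only [Finset.mem_inter, Finset.mem_image, Finset.mem_erase] at hb ⊢
    obtain ⟨⟨v, hv, rfl⟩, hA⟩ := hb
    by_cases hvw : v = w
    · obtain ⟨u, hu, huw, hc⟩ := hw v hv hA hvw
      exact ⟨u, ⟨huw, hu⟩, by rw [hc, hvw]⟩
    · exact ⟨v, ⟨hvw, hv⟩, rfl⟩
  rcases h with h | h | h
  · exact aux x hx (sub x fun v _ _ _ => ⟨y, hy, hxy.symm, h.symm⟩)
  · exact aux x hx (sub x fun v _ hA hv => absurd (hv ▸ hA) h)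
  · exact aux y hy (sub y fun v _ hA hv => absurd (hv ▸ hA) h)

/-- Coloring two nonadjacent pairs in a way that saves two colors at `z` and one at `z'`. -/
lemma colorableOn_of_two_pairs {W : Finset V} {L : V → Finset ℕ} {x₁ y₁ x₂ y₂ z z' : V}
    {a₁ b₁ a₂ b₂ : ℕ} (hW : ({x₁, y₁, x₂, y₂, z, z'} : Finset V) ⊆ W)
    (hnd : [x₁, y₁, x₂, y₂, z, z'].Nodup) (h₁ : ¬ G.Adj x₁ y₁) (h₂ : ¬ G.Adj x₂ y₂)
    (ha₁ : a₁ ∈ L x₁) (hb₁ : b₁ ∈ L y₁) (ha₂ : a₂ ∈ L x₂) (hb₂ : b₂ ∈ L y₂)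
    (haa : a₁ ≠ a₂) (hab : a₁ ≠ b₂) (hba : b₁ ≠ a₂) (hbb : b₁ ≠ b₂)
    (hzP : ∀ v ∈ ({x₁, y₁, x₂, y₂} : Finset V), G.Adj z v)
    (hz : (({a₁, b₁, a₂, b₂} : Finset ℕ) ∩ L z).card + (nbr G W z).card < (L z).card + 4)
    (hzx : G.Adj z' x₁) (hzy : G.Adj z' y₁) (hs : a₁ = b₁ ∨ a₁ ∉ L z' ∨ b₁ ∉ L z')
    (hz' : ((nbr G W z').erase z).card ≤ (L z').card)
    (hU : ∀ U ⊆ W \ {x₁, y₁, x₂, y₂, z, z'}, U.Nonempty →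
      ∃ u ∈ U, (nbr G (U ∪ {x₁, y₁, x₂, y₂}) u).card < (L u).card) :
    ColorableOn G W L := by
  set P : Finset V := {x₁, y₁, x₂, y₂} with hP
  simp only [List.nodup_cons, List.mem_cons, List.not_mem_nil, or_false, not_or,
    not_false_eq_true, List.nodup_nil, and_true] at hnd
  obtain ⟨⟨n1, n2, n3, n4, n5⟩, ⟨n6, n7, n8, n9⟩, ⟨n10, n11, n12⟩, ⟨n13, n14⟩, n15⟩ := hnd
  have hPW : P ⊆ W := by
    refine subset_trans ?_ hW
    intro v hv
    simp only [hP, Finset.mem_insert, Finset.mem_singleton] at hv ⊢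
    rcases hv with h | h | h | h <;> simp [h]
  have hzmem : z ∉ P := by
    simp only [hP, Finset.mem_insert, Finset.mem_singleton, not_or]
    exact ⟨Ne.symm n4, Ne.symm n8, Ne.symm n11, Ne.symm n13⟩
  let c : V → ℕ := fun v => if v = x₁ then a₁ else if v = y₁ then b₁ else if v = x₂ then a₂ else b₂
  have c1 : c x₁ = a₁ := by simp [c]
  have c2 : c y₁ = b₁ := by simp [c, Ne.symm n1]
  have c3 : c x₂ = a₂ := by simp [c, Ne.symm n2, Ne.symm n6]
  have c4 : c y₂ = b₂ := by simp [c, Ne.symm n3, Ne.symm n7, Ne.symm n10]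
  have hPc : P.card = 4 := by
    rw [hP]
    simp [n1, n2, n3, n6, n7, n10]
  rw [← Finset.union_sdiff_of_subset hPW]
  refine colorableOn_of_degenerate (W \ P) P c Finset.disjoint_sdiff ?_ ?_ ?_
  · simp only [hP, Finset.mem_insert, Finset.mem_singleton]
    rintro v (rfl | rfl | rfl | rfl)
    · rwa [c1]
    · rwa [c2]
    · rwa [c3]
    · rwa [c4]
  · simp only [hP, Finset.mem_insert, Finset.mem_singleton]
    have h₁' : ¬ G.Adj y₁ x₁ := fun h => h₁ h.symm
    have h₂' : ¬ G.Adj y₂ x₂ := fun h => h₂ h.symm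
    rintro u (rfl | rfl | rfl | rfl) v (rfl | rfl | rfl | rfl) huv
    all_goals first
      | exact absurd huv (G.loopless.irrefl _)
      | exact absurd huv ‹_›
      | (simp only [c1, c2, c3, c4]; first | assumption | exact Ne.symm ‹_›)
  · intro U hUR hne
    have hUW : U ⊆ W := hUR.trans Finset.sdiff_subset
    have hdisj : ∀ u, Disjoint (nbr G P u) (nbr G U u) := by
      intro u
      refine Finset.disjoint_left.2 fun v hv hv' => ?_
      exact (Finset.mem_sdiff.1 (hUR (mem_nbr.1 hv').1)).2 (mem_nbr.1 hv).1
    by_cases hzU : z ∈ U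
    · refine ⟨z, hzU, ?_⟩
      have hnP : nbr G P z = P := by
        ext v
        rw [mem_nbr]
        exact ⟨fun h => h.1, fun h => ⟨h, hzP v h⟩⟩
      have hle : (nbr G P z).card + (nbr G U z).card ≤ (nbr G W z).card := by
        rw [← Finset.card_union_of_disjoint (hdisj z)]
        exact Finset.card_le_card (Finset.union_subset (nbr_mono hPW z) (nbr_mono hUW z))
      have himg : (nbr G P z).image c = {a₁, b₁, a₂, b₂} := by
        rw [hnP, hP]
        simp [Finset.image_insert, c1, c2, c3, c4]
      rw [himg]
      rw [hnP] at hle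
      omega
    by_cases hzU' : z' ∈ U
    · refine ⟨z', hzU', ?_⟩
      have hle : (nbr G P z').card + (nbr G U z').card ≤ ((nbr G W z').erase z).card := by
        rw [← Finset.card_union_of_disjoint (hdisj z')]
        refine Finset.card_le_card fun v hv => ?_
        refine Finset.mem_erase.2 ⟨?_, Finset.union_subset (nbr_mono hPW z') (nbr_mono hUW z') hv⟩
        rintro rfl
        rcases Finset.mem_union.1 hv with h | h
        · exact hzmem (mem_nbr.1 h).1
        · exact hzU (mem_nbr.1 h).1
      have := card_image_inter_lt (S := nbr G P z') (c := c) (A := L z') (x := x₁) (y := y₁)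
        (mem_nbr.2 ⟨by simp [hP], hzx⟩) (mem_nbr.2 ⟨by simp [hP], hzy⟩) n1 (by rwa [c1, c2])
      omega
    · obtain ⟨u, hu, hlt⟩ := hU U (by
        intro v hv
        have h1 := hUR hv
        simp only [hP, Finset.mem_sdiff, Finset.mem_insert, Finset.mem_singleton] at h1 ⊢
        refine ⟨h1.1, ?_⟩
        rintro (h | h | h | h | rfl | rfl)
        · exact h1.2 (Or.inl h)
        · exact h1.2 (Or.inr (Or.inl h))
        · exact h1.2 (Or.inr (Or.inr (Or.inl h)))
        · exact h1.2 (Or.inr (Or.inr (Or.inr h)))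
        · exact hzU hv
        · exact hzU' hv) hne
      refine ⟨u, hu, lt_of_le_of_lt ?_ hlt⟩
      have h1 : ((nbr G P u).image c ∩ L u).card ≤ (nbr G P u).card :=
        (Finset.card_le_card Finset.inter_subset_left).trans Finset.card_image_le
      have h2 : (nbr G P u).card + (nbr G U u).card ≤ (nbr G (U ∪ P) u).card := by
        rw [← Finset.card_union_of_disjoint (hdisj u)]
        exact Finset.card_le_card (Finset.union_subset (nbr_mono Finset.subset_union_right u)
          (nbr_mono Finset.subset_union_left u))
      omega

lemma exists_saving_pair {A B Z : Finset ℕ} (hA : A.Nonempty) (hB : B.Nonempty)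
    (h : Z.card < A.card + B.card) : ∃ a ∈ A, ∃ b ∈ B, a = b ∨ a ∉ Z ∨ b ∉ Z := by
  by_contra! hcon
  obtain ⟨a₀, ha₀⟩ := hA
  obtain ⟨b₀, hb₀⟩ := hB
  have hd : Disjoint A B := Finset.disjoint_left.2 fun a ha hb => (hcon a ha a hb).1 rfl
  have hsub : A ∪ B ⊆ Z := by
    intro a ha
    rcases Finset.mem_union.1 ha with h | h
    · exact (hcon a h b₀ hb₀).2.1
    · exact (hcon a₀ ha₀ a h).2.2
  have := Finset.card_le_card hsub
  rw [Finset.card_union_of_disjoint hd] at this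
  omega

lemma exists_saving_pair_two {A B Z Z' : Finset ℕ} {k : ℕ} (hk : 0 < k) (hA : A.card = k)
    (hB : B.card = k) (hZ : Z.card = k) (hZ' : Z'.card = k) :
    ∃ a ∈ A, ∃ b ∈ B, (a = b ∨ a ∉ Z ∨ b ∉ Z) ∧ (a = b ∨ a ∉ Z' ∨ b ∉ Z') := by
  by_contra! hcon
  have hd : ∀ a ∈ A, a ∉ B := fun a ha hb => by simpa using hcon a ha a hb
  obtain ⟨a₀, ha₀⟩ : A.Nonempty := Finset.card_pos.1 (by omega)
  obtain ⟨b₀, hb₀⟩ : B.Nonempty := Finset.card_pos.1 (by omega)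
  have heq : ∀ {S T : Finset ℕ}, S.card = k → T.card = k → S ⊆ T → S = T :=
    fun hS hT h => Finset.eq_of_subset_of_card_le h (by omega)
  have key1 : A ⊆ Z ∨ B ⊆ Z' := by
    by_contra! h
    obtain ⟨a, ha, haZ⟩ := Finset.not_subset.1 h.1
    obtain ⟨b, hb, hbZ⟩ := Finset.not_subset.1 h.2
    exact hbZ (hcon a ha b hb (Or.inr (Or.inl haZ))).2.2
  have key2 : A ⊆ Z' ∨ B ⊆ Z := by
    by_contra! h
    obtain ⟨a, ha, haZ⟩ := Finset.not_subset.1 h.1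
    obtain ⟨b, hb, hbZ⟩ := Finset.not_subset.1 h.2
    exact haZ (hcon a ha b hb (Or.inr (Or.inr hbZ))).2.1
  have h0 := hd a₀ ha₀
  have h0' : b₀ ∉ A := fun h => hd b₀ h hb₀
  rcases key1 with h | h
  · have hAZ := heq hA hZ h
    rcases key2 with h' | h'
    · have hAZ' := heq hA hZ' h'
      have := hcon a₀ ha₀ b₀ hb₀ (Or.inr (Or.inr (hAZ ▸ h0')))
      exact h0' (hAZ' ▸ this.2.2)
    · exact h0 (heq hB hZ h' ▸ hAZ ▸ ha₀)
  · have hBZ' := heq hB hZ' h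
    rcases key2 with h' | h'
    · exact h0 (hBZ' ▸ heq hA hZ' h' ▸ ha₀)
    · have hBZ := heq hB hZ h'
      have := hcon a₀ ha₀ b₀ hb₀ (Or.inr (Or.inl (hBZ ▸ h0)))
      exact h0 (hBZ' ▸ this.2.1)

lemma card_inter_le_two_of_saved {a₁ b₁ a₂ b₂ : ℕ} {Z : Finset ℕ}
    (h₁ : a₁ = b₁ ∨ a₁ ∉ Z ∨ b₁ ∉ Z) (h₂ : a₂ = b₂ ∨ a₂ ∉ Z ∨ b₂ ∉ Z) :
    (({a₁, b₁, a₂, b₂} : Finset ℕ) ∩ Z).card ≤ 2 := by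
  have aux : ∀ {a b : ℕ}, (a = b ∨ a ∉ Z ∨ b ∉ Z) → ∃ d, ({a, b} : Finset ℕ) ∩ Z ⊆ {d} := by
    rintro a b (rfl | h | h)
    · refine ⟨a, fun t ht => ?_⟩
      simp only [Finset.mem_inter, Finset.mem_insert, Finset.mem_singleton, or_self] at ht ⊢
      exact ht.1
    · refine ⟨b, fun t ht => ?_⟩
      simp only [Finset.mem_inter, Finset.mem_insert, Finset.mem_singleton] at ht ⊢
      rcases ht with ⟨rfl | rfl, h'⟩
      · exact absurd h' h
      · rfl
    · refine ⟨a, fun t ht => ?_⟩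
      simp only [Finset.mem_inter, Finset.mem_insert, Finset.mem_singleton] at ht ⊢
      rcases ht with ⟨rfl | rfl, h'⟩
      · rfl
      · exact absurd h' h
  obtain ⟨d, hd⟩ := aux h₁
  obtain ⟨d', hd'⟩ := aux h₂
  have : ({a₁, b₁, a₂, b₂} : Finset ℕ) ∩ Z ⊆ {d, d'} := by
    intro t ht
    have e1 := @hd t
    have e2 := @hd' t
    simp only [Finset.mem_inter, Finset.mem_insert, Finset.mem_singleton] at ht e1 e2 ⊢
    tauto
  exact (Finset.card_le_card this).trans Finset.card_le_two

/-- Two nonadjacent pairs near `z`, `z'` suffice when all lists have size `k`. -/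
lemma colorableOn_of_uniform_lists {W : Finset V} {L : V → Finset ℕ} {k : ℕ} (hk : 8 ≤ k)
    (hL : ∀ v, (L v).card = k) {x₁ y₁ x₂ y₂ z z' : V}
    (hW : ({x₁, y₁, x₂, y₂, z, z'} : Finset V) ⊆ W)
    (hnd : [x₁, y₁, x₂, y₂, z, z'].Nodup) (h₁ : ¬ G.Adj x₁ y₁) (h₂ : ¬ G.Adj x₂ y₂)
    (hzP : ∀ v ∈ ({x₁, y₁, x₂, y₂} : Finset V), G.Adj z v)
    (hz : (nbr G W z).card ≤ k + 1)
    (hzx : G.Adj z' x₁) (hzy : G.Adj z' y₁)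
    (hz' : ((nbr G W z').erase z).card ≤ k)
    (hU : ∀ U ⊆ W \ {x₁, y₁, x₂, y₂, z, z'}, U.Nonempty →
      ∃ u ∈ U, (nbr G (U ∪ {x₁, y₁, x₂, y₂}) u).card < k) :
    ColorableOn G W L := by
  obtain ⟨a₁, ha₁, b₁, hb₁, hs, hs'⟩ := exists_saving_pair_two (by omega) (hL x₁) (hL y₁) (hL z)
    (hL z')
  have hc : ∀ v, k - 2 ≤ (L v \ {a₁, b₁}).card := by
    intro v
    have h1 := Finset.le_card_sdiff {a₁, b₁} (L v)
    have h2 : ({a₁, b₁} : Finset ℕ).card ≤ 2 := Finset.card_le_two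
    have h3 := hL v
    omega
  have hx := hc x₂
  have hy := hc y₂
  obtain ⟨a₂, ha₂, b₂, hb₂, hs₂⟩ := exists_saving_pair (A := L x₂ \ {a₁, b₁})
    (B := L y₂ \ {a₁, b₁}) (Z := L z) (Finset.card_pos.1 (by omega)) (Finset.card_pos.1 (by omega))
    (by rw [hL]; omega)
  simp only [Finset.mem_sdiff, Finset.mem_insert, Finset.mem_singleton, not_or] at ha₂ hb₂
  have hsave := card_inter_le_two_of_saved hs hs₂
  refine colorableOn_of_two_pairs hW hnd h₁ h₂ ha₁ hb₁ ha₂.1 hb₂.1 (Ne.symm ha₂.2.1)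
    (Ne.symm hb₂.2.1) (Ne.symm ha₂.2.2) (Ne.symm hb₂.2.2) hzP ?_ hzx hzy hs' ?_ ?_
  · rw [hL]; omega
  · rwa [hL]
  · simpa only [hL] using hU

lemma card_nbr_of_universal {X : Finset V} {z : V} (hz : z ∈ X)
    (h : ∀ v ∈ X, v ≠ z → G.Adj z v) : (nbr G X z).card = X.card - 1 := by
  have : nbr G X z = X.erase z := by
    ext v
    rw [mem_nbr, Finset.mem_erase]
    exact ⟨fun hv => ⟨hv.2.ne', hv.1⟩, fun hv => ⟨hv.2, h v hv.2 hv.1⟩⟩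
  rw [this, Finset.card_erase_of_mem hz]

lemma card_nbr_add_le {X U : Finset V} {u z z' : V} (hUX : U ⊆ X) (hz : z ∈ X) (hz' : z' ∈ X)
    (hzz : z ≠ z') (hzU : z ∉ U) (hzU' : z' ∉ U) (h : G.Adj u z) (h' : G.Adj u z') :
    (nbr G U u).card + 2 ≤ (nbr G X u).card := by
  have hd : Disjoint (nbr G U u) {z, z'} := by
    rw [Finset.disjoint_left]
    intro v hv hv'
    have := (mem_nbr.1 hv).1
    simp only [Finset.mem_insert, Finset.mem_singleton] at hv'
    rcases hv' with rfl | rfl <;> contradiction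
  rw [← Finset.card_pair hzz, ← Finset.card_union_of_disjoint hd]
  refine Finset.card_le_card (Finset.union_subset (nbr_mono hUX u) ?_)
  intro v hv
  simp only [Finset.mem_insert, Finset.mem_singleton] at hv
  rcases hv with rfl | rfl
  · exact mem_nbr.2 ⟨hz, h⟩
  · exact mem_nbr.2 ⟨hz', h'⟩

/-- Lists one short of the degree suffice when two universal vertices accompany two disjoint
nonadjacent pairs of large degree sum. -/
lemma colorableOn_of_degree_sum {X : Finset V} {L : V → Finset ℕ} {x₁ y₁ x₂ y₂ z z' : V}
    (hX : ({x₁, y₁, x₂, y₂, z, z'} : Finset V) ⊆ X)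
    (hnd : [x₁, y₁, x₂, y₂, z, z'].Nodup) (h₁ : ¬ G.Adj x₁ y₁) (h₂ : ¬ G.Adj x₂ y₂)
    (hz : ∀ v ∈ X, v ≠ z → G.Adj z v) (hz' : ∀ v ∈ X, v ≠ z' → G.Adj z' v)
    (hs₁ : X.card + 2 ≤ (nbr G X x₁).card + (nbr G X y₁).card)
    (hs₂ : X.card + 2 ≤ (nbr G X x₂).card + (nbr G X y₂).card)
    (hL : ∀ v ∈ X, (nbr G X v).card ≤ (L v).card + 1) : ColorableOn G X L := by
  have mX : x₁ ∈ X ∧ y₁ ∈ X ∧ x₂ ∈ X ∧ y₂ ∈ X ∧ z ∈ X ∧ z' ∈ X := by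
    refine ⟨hX ?_, hX ?_, hX ?_, hX ?_, hX ?_, hX ?_⟩ <;> simp
  obtain ⟨mx₁, my₁, mx₂, my₂, mz, mz'⟩ := mX
  have hnd' := hnd
  simp only [List.nodup_cons, List.mem_cons, List.not_mem_nil, or_false, not_or,
    not_false_eq_true, List.nodup_nil, and_true] at hnd'
  obtain ⟨⟨n1, n2, n3, n4, n5⟩, ⟨n6, n7, n8, n9⟩, ⟨n10, n11, n12⟩, ⟨n13, n14⟩, n15⟩ := hnd'
  have hlt : ∀ v ∈ X, (nbr G X v).card ≤ X.card - 1 := by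
    intro v hv
    rw [← Finset.card_erase_of_mem hv]
    exact Finset.card_le_card (nbr_subset_erase X v)
  have hpos : 0 < X.card := Finset.card_pos.2 ⟨_, mz⟩
  refine colorableOn_of_small_pot (f := fun v => (nbr G X v).card - 1) (fun v hv => ?_)
    (fun L hL hpot => ?_) L (fun v hv => ?_)
  · have := hlt v hv
    omega
  · have e1 := hlt _ mx₁
    have e2 := hlt _ my₁
    have e3 := hlt _ mx₂
    have e4 := hlt _ my₂
    obtain ⟨a, hax, hay⟩ := exists_common_color mx₁ my₁ hpot (by
      rw [hL _ mx₁, hL _ my₁]; omega)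
    have zc := card_nbr_of_universal mz hz
    have zc' := card_nbr_of_universal mz' hz'
    have lz : (L z).card = X.card - 2 := by rw [hL z mz, zc]; omega
    have lz' : (L z').card = X.card - 2 := by rw [hL z' mz', zc']; omega
    have hxe : (L x₂).card - 1 ≤ ((L x₂).erase a).card := Finset.pred_card_le_card_erase
    have hye : (L y₂).card - 1 ≤ ((L y₂).erase a).card := Finset.pred_card_le_card_erase
    have lx := hL _ mx₂
    have ly := hL _ my₂
    obtain ⟨a₂, ha₂, b₂, hb₂, hs⟩ : ∃ a₂ ∈ (L x₂).erase a, ∃ b₂ ∈ (L y₂).erase a,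
        (({a, a, a₂, b₂} : Finset ℕ) ∩ L z).card ≤ 2 := by
      have hxne : ((L x₂).erase a).Nonempty := Finset.card_pos.1 (by omega)
      have hyne : ((L y₂).erase a).Nonempty := Finset.card_pos.1 (by omega)
      by_cases haz : a ∈ L z
      · obtain ⟨a₂, ha₂, b₂, hb₂, hs⟩ := exists_saving_pair (Z := (L z).erase a) hxne hyne
          (by rw [Finset.card_erase_of_mem haz]; omega)
        refine ⟨a₂, ha₂, b₂, hb₂, card_inter_le_two_of_saved (Or.inl rfl) ?_⟩
        rcases hs with h | h | h
        · exact Or.inl h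
        · exact Or.inr (Or.inl fun h' => h (Finset.mem_erase.2 ⟨(Finset.mem_erase.1 ha₂).1, h'⟩))
        · exact Or.inr (Or.inr fun h' => h (Finset.mem_erase.2 ⟨(Finset.mem_erase.1 hb₂).1, h'⟩))
      · obtain ⟨a₂, ha₂⟩ := hxne
        obtain ⟨b₂, hb₂⟩ := hyne
        refine ⟨a₂, ha₂, b₂, hb₂, ?_⟩
        have hsub : ({a, a, a₂, b₂} : Finset ℕ) ∩ L z ⊆ {a₂, b₂} := by
          intro t ht
          simp only [Finset.mem_inter, Finset.mem_insert, Finset.mem_singleton] at ht ⊢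
          rcases ht with ⟨rfl | rfl | h, h'⟩
          · exact absurd h' haz
          · exact absurd h' haz
          · exact h
        exact (Finset.card_le_card hsub).trans Finset.card_le_two
    rw [Finset.mem_erase] at ha₂ hb₂
    have hPX : ({x₁, y₁, x₂, y₂} : Finset V) ⊆ X := by
      simp [Finset.insert_subset_iff, mx₁, my₁, mx₂, my₂]
    have hPz : ∀ v ∈ ({x₁, y₁, x₂, y₂} : Finset V), v ≠ z ∧ v ≠ z' := by
      simp [n4, n5, n8, n9, n11, n12, n13, n14]
    refine colorableOn_of_two_pairs hX hnd h₁ h₂ hax hay ha₂.2 hb₂.2 ha₂.1.symm hb₂.1.symm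
      ha₂.1.symm hb₂.1.symm (fun v hv => hz v (hPX hv) (hPz v hv).1) ?_ (hz' _ mx₁ n5)
      (hz' _ my₁ n9) (Or.inl rfl) ?_ ?_
    · omega
    · rw [Finset.card_erase_of_mem (mem_nbr.2 ⟨mz, hz' z mz n15⟩)]
      omega
    · rintro U hU ⟨u, hu⟩
      refine ⟨u, hu, ?_⟩
      have hu' := hU hu
      simp only [Finset.mem_sdiff, Finset.mem_insert, Finset.mem_singleton, not_or] at hu'
      have hnot : ∀ w ∈ ({z, z'} : Finset V), w ∉ U := by
        intro w hw h
        have := hU h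
        simp only [Finset.mem_sdiff, Finset.mem_insert, Finset.mem_singleton, not_or] at this hw
        rcases hw with rfl | rfl
        · exact this.2.2.2.2.2.1 rfl
        · exact this.2.2.2.2.2.2 rfl
      have := card_nbr_add_le (G := G) (X := X) (U := U ∪ {x₁, y₁, x₂, y₂}) (u := u)
        (Finset.union_subset (hU.trans Finset.sdiff_subset) hPX) mz mz' n15
        (fun h => (Finset.mem_union.1 h).elim (hnot z (by simp)) fun h => (hPz z h).1 rfl)
        (fun h => (Finset.mem_union.1 h).elim (hnot z' (by simp)) fun h => (hPz z' h).2 rfl)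
        (hz u hu'.1 hu'.2.2.2.2.2.1).symm (hz' u hu'.1 hu'.2.2.2.2.2.2).symm
      have := hL u hu'.1
      omega
  · have := hL v hv
    omega

/-- One nonadjacent pair of large degree sum suffices when one of two universal vertices has a
list as large as its degree. -/
lemma colorableOn_of_degree_sum_of_large_list {X : Finset V} {L : V → Finset ℕ} {x y z z' : V}
    (hx : x ∈ X) (hy : y ∈ X) (hzX : z ∈ X) (hzX' : z' ∈ X) (hxy : x ≠ y) (hxz : x ≠ z)
    (hxz' : x ≠ z') (hyz : y ≠ z) (hyz' : y ≠ z') (hzz : z ≠ z') (h : ¬ G.Adj x y)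
    (hz : ∀ v ∈ X, v ≠ z → G.Adj z v) (hz' : ∀ v ∈ X, v ≠ z' → G.Adj z' v)
    (hs : X.card + 2 ≤ (nbr G X x).card + (nbr G X y).card)
    (hL : ∀ v ∈ X, (nbr G X v).card ≤ (L v).card + 1) (hLz : (nbr G X z).card ≤ (L z).card) :
    ColorableOn G X L := by
  have hlt : ∀ v ∈ X, (nbr G X v).card ≤ X.card - 1 := by
    intro v hv
    rw [← Finset.card_erase_of_mem hv]
    exact Finset.card_le_card (nbr_subset_erase X v)
  have hpos : 0 < X.card := Finset.card_pos.2 ⟨_, hzX⟩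
  refine colorableOn_of_small_pot
    (f := fun v => if v = z then (nbr G X v).card else (nbr G X v).card - 1) (fun v hv => ?_)
    (fun L hL hpot => ?_) L (fun v hv => ?_)
  · have := hlt v hv
    split_ifs <;> omega
  · have e1 := hlt _ hx
    have e2 := hlt _ hy
    have lx := hL x hx
    have ly := hL y hy
    have lz := hL z hzX
    have lz' := hL z' hzX'
    rw [if_neg hxz] at lx
    rw [if_neg hyz] at ly
    rw [if_pos rfl, card_nbr_of_universal hzX hz] at lz
    rw [if_neg hzz.symm, card_nbr_of_universal hzX' hz'] at lz'
    obtain ⟨a, hax, hay⟩ := exists_common_color hx hy hpot (by omega)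
    have hPX : ({x, y} : Finset V) ⊆ X := by simp [Finset.insert_subset_iff, hx, hy]
    rw [← Finset.union_sdiff_of_subset hPX]
    refine colorableOn_of_degenerate (X \ {x, y}) {x, y} (fun _ => a) Finset.disjoint_sdiff ?_ ?_ ?_
    · simp [hax, hay]
    · simp only [Finset.mem_insert, Finset.mem_singleton]
      rintro u (rfl | rfl) v (rfl | rfl) huv
      · exact absurd huv (G.loopless.irrefl _)
      · exact absurd huv h
      · exact absurd huv.symm h
      · exact absurd huv (G.loopless.irrefl _)
    · intro U hU hne
      have himg : ∀ u, ((nbr G {x, y} u).image (fun _ => a) ∩ L u).card ≤ 1 := by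
        intro u
        refine (Finset.card_le_card (Finset.inter_subset_left.trans ?_)).trans
          (Finset.card_singleton a).le
        intro t ht
        simp only [Finset.mem_image] at ht
        obtain ⟨_, -, rfl⟩ := ht
        simp
      have hUc : U.card + 2 ≤ X.card := by
        have := Finset.card_le_card hU
        rw [Finset.card_sdiff_of_subset hPX, Finset.card_pair hxy] at this
        have := Finset.card_le_card hPX
        rw [Finset.card_pair hxy] at this
        omega
      have hUn : ∀ u ∈ U, (nbr G U u).card + 1 ≤ U.card := by
        intro u hu
        have := Finset.card_le_card (nbr_subset_erase (G := G) U u)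
        rw [Finset.card_erase_of_mem hu] at this
        have : 0 < U.card := Finset.card_pos.2 ⟨u, hu⟩
        omega
      by_cases hzU : z ∈ U
      · refine ⟨z, hzU, ?_⟩
        have := himg z
        have := hUn z hzU
        omega
      by_cases hzU' : z' ∈ U
      · refine ⟨z', hzU', ?_⟩
        have h1 := himg z'
        have h2 := hUn z' hzU'
        have h3 : U.card + 3 ≤ X.card := by
          have : U ∪ {x, y, z} ⊆ X := by
            refine Finset.union_subset (hU.trans Finset.sdiff_subset) ?_
            simp [Finset.insert_subset_iff, hx, hy, hzX]
          have hc := Finset.card_le_card this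
          rw [Finset.card_union_of_disjoint] at hc
          · have : ({x, y, z} : Finset V).card = 3 := by simp [hxy, hxz, hyz]
            omega
          · rw [Finset.disjoint_left]
            intro v hv hv'
            have := (Finset.mem_sdiff.1 (hU hv)).2
            simp only [Finset.mem_insert, Finset.mem_singleton, not_or] at this hv'
            rcases hv' with rfl | rfl | rfl
            · exact this.1 rfl
            · exact this.2 rfl
            · exact hzU hv
        omega
      · obtain ⟨u, hu⟩ := hne
        refine ⟨u, hu, ?_⟩
        have huX := Finset.mem_sdiff.1 (hU hu)
        have hPz : ∀ v ∈ ({x, y} : Finset V), v ≠ z ∧ v ≠ z' := by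
          simp [hxz, hxz', hyz, hyz']
        have huz : u ≠ z := by rintro rfl; exact hzU hu
        have huz' : u ≠ z' := by rintro rfl; exact hzU' hu
        have h2 := card_nbr_add_le (G := G) (X := X) (U := U ∪ {x, y}) (u := u)
          (Finset.union_subset (hU.trans Finset.sdiff_subset) hPX) hzX hzX' hzz
          (fun h => (Finset.mem_union.1 h).elim hzU fun h => (hPz z h).1 rfl)
          (fun h => (Finset.mem_union.1 h).elim hzU' fun h => (hPz z' h).2 rfl)
          (hz u huX.1 huz).symm (hz' u huX.1 huz').symm
        have h3 : ((nbr G {x, y} u).image (fun _ => a) ∩ L u).card ≤ (nbr G {x, y} u).card :=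
          (Finset.card_le_card Finset.inter_subset_left).trans Finset.card_image_le
        have h4 : (nbr G {x, y} u).card + (nbr G U u).card ≤ (nbr G (U ∪ {x, y}) u).card := by
          rw [← Finset.card_union_of_disjoint]
          · exact Finset.card_le_card (Finset.union_subset (nbr_mono Finset.subset_union_right u)
              (nbr_mono Finset.subset_union_left u))
          · refine Finset.disjoint_left.2 fun v hv hv' => ?_
            exact (Finset.mem_sdiff.1 (hU (mem_nbr.1 hv').1)).2 (mem_nbr.1 hv).1
        have h5 := hL u huX.1
        rw [if_neg huz] at h5
        omega
  · have := hL v hv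
    split_ifs with hvz
    · rw [hvz]; exact hLz
    · omega

section Critical

variable {W : Finset V} {L : V → Finset ℕ} {k : ℕ}

lemma card_nbr_add_card_nbr_sdiff {X : Finset V} (hX : X ⊆ W) (v : V) :
    (nbr G X v).card + (nbr G (W \ X) v).card = (nbr G W v).card := by
  rw [← Finset.card_union_of_disjoint]
  · congr 1
    ext u
    simp only [Finset.mem_union, mem_nbr, Finset.mem_sdiff]
    have := @hX u
    tauto
  · rw [Finset.disjoint_left]
    intro u hu hu'
    exact (Finset.mem_sdiff.1 (mem_nbr.1 hu').1).2 (mem_nbr.1 hu).1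

lemma Critical.residual (hC : Critical G W L k) {X : Finset V} (hX : X ⊆ W) (hne : X.Nonempty) :
    ∃ L' : V → Finset ℕ, (∀ v ∈ X, k + (nbr G X v).card ≤ (L' v).card + (nbr G W v).card) ∧
      ¬ ColorableOn G X L' := by
  obtain ⟨c, hc, hcadj⟩ := hC.colorable (W \ X) (by
    refine Finset.ssubset_iff_subset_ne.2 ⟨Finset.sdiff_subset, fun h => ?_⟩
    obtain ⟨x, hx⟩ := hne
    have := hX hx
    rw [← h] at this
    exact (Finset.mem_sdiff.1 this).2 hx)
  refine ⟨fun v => L v \ (nbr G (W \ X) v).image c, fun v _ => ?_, ?_⟩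
  · have h1 := Finset.le_card_sdiff ((nbr G (W \ X) v).image c) (L v)
    have h2 : ((nbr G (W \ X) v).image c).card ≤ _ := Finset.card_image_le
    have h3 := card_nbr_add_card_nbr_sdiff (G := G) hX v
    rw [hC.card_list] at h1
    dsimp only
    omega
  · rintro ⟨d, hd, hdadj⟩
    refine hC.not_colorable ⟨fun v => if v ∈ X then d v else c v, fun v hv => ?_,
      fun u hu v hv huv => ?_⟩
    · dsimp only
      by_cases hvX : v ∈ X
      · rw [if_pos hvX]
        exact (Finset.mem_sdiff.1 (hd v hvX)).1
      · rw [if_neg hvX]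
        exact hc v (Finset.mem_sdiff.2 ⟨hv, hvX⟩)
    · have key : ∀ u ∈ X, ∀ v ∈ W, v ∉ X → G.Adj u v → d u ≠ c v := by
        intro u hu v hv hvX huv h
        refine (Finset.mem_sdiff.1 (hd u hu)).2 (Finset.mem_image.2 ⟨v, ?_, h.symm⟩)
        exact mem_nbr.2 ⟨Finset.mem_sdiff.2 ⟨hv, hvX⟩, huv⟩
      by_cases hu' : u ∈ X <;> by_cases hv' : v ∈ X <;> simp only [hu', hv', if_true, if_false]
      · exact hdadj u hu' v hv' huv
      · exact key u hu' v hv hv' huv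
      · exact (key v hv' u hu hu' huv.symm).symm
      · exact hcadj u (Finset.mem_sdiff.2 ⟨hu, hu'⟩) v (Finset.mem_sdiff.2 ⟨hv, hv'⟩) huv

lemma Critical.le_nbr (hC : Critical G W L k) {v : V} (hv : v ∈ W) : k ≤ (nbr G W v).card := by
  obtain ⟨L', h, hn⟩ := hC.residual (X := {v}) (by simpa using hv) (by simp)
  by_contra! hlt
  have := h v (by simp)
  obtain ⟨a, ha⟩ : (L' v).Nonempty := Finset.card_pos.1 (by omega)
  refine hn ⟨fun _ => a, by simpa using ha, ?_⟩
  intro u hu w hw huw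
  rw [Finset.mem_singleton] at hu hw
  exact absurd (hu.trans hw.symm) huw.ne

lemma card_add_card_nbr_le {T : Finset V} {v : V} (hv : v ∈ W)
    (hT : ∀ u ∈ T, u ∈ W ∧ u ≠ v ∧ ¬ G.Adj v u) :
    T.card + (nbr G W v).card + 1 ≤ W.card := by
  have h1 := Finset.card_sdiff_add_card_eq_card (nbr_subset_erase (G := G) W v)
  have h3 := Finset.card_erase_add_one hv
  have h2 : T.card ≤ (W.erase v \ nbr G W v).card := by
    refine Finset.card_le_card fun u hu => ?_
    obtain ⟨a, b, c⟩ := hT u hu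
    simp [mem_nbr, a, b, c]
  omega

lemma Critical.card_add_le (hC : Critical G W L k) {T : Finset V} {v : V} (hv : v ∈ W)
    (hT : ∀ u ∈ T, u ∈ W ∧ u ≠ v ∧ ¬ G.Adj v u) : T.card + k + 1 ≤ W.card := by
  have := card_add_card_nbr_le hv hT
  have := hC.le_nbr hv
  omega

lemma Critical.le_card (hC : Critical G W L k) : k + 2 ≤ W.card := by
  by_contra! hlt
  have hne : W.Nonempty := by
    rw [Finset.nonempty_iff_ne_empty]
    rintro rfl
    exact hC.not_colorable ⟨fun _ => 0, by simp, by simp⟩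
  obtain ⟨w, hw⟩ := hne
  have h1 := hC.card_add_le (T := ∅) hw (by simp)
  obtain ⟨u, hu, v, hv, huv, hadj⟩ := hC.exists_not_adj subset_rfl (by omega)
  have h2 := hC.card_add_le (T := {v}) hu (by simp [hv, huv.symm, hadj])
  rw [Finset.card_singleton] at h2
  omega

lemma Critical.exists_two_pairs (hC : Critical G W L k) :
    ∃ x₁ ∈ W, ∃ y₁ ∈ W, ∃ x₂ ∈ W, ∃ y₂ ∈ W, [x₁, y₁, x₂, y₂].Nodup ∧
      ¬ G.Adj x₁ y₁ ∧ ¬ G.Adj x₂ y₂ := by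
  have hcard := hC.le_card
  obtain ⟨x₁, hx₁, y₁, hy₁, hne, h₁⟩ := hC.exists_not_adj subset_rfl (by omega)
  have c1 := Finset.card_erase_add_one hx₁
  have hy₁' : y₁ ∈ W.erase x₁ := Finset.mem_erase.2 ⟨hne.symm, hy₁⟩
  have c2 := Finset.card_erase_add_one hy₁'
  suffices H : ∃ x₂ ∈ (W.erase x₁).erase y₁, ∃ y₂ ∈ (W.erase x₁).erase y₁, x₂ ≠ y₂ ∧
      ¬ G.Adj x₂ y₂ by
    obtain ⟨x₂, hx₂, y₂, hy₂, hne', h₂⟩ := H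
    simp only [Finset.mem_erase] at hx₂ hy₂
    refine ⟨x₁, hx₁, y₁, hy₁, x₂, hx₂.2.2, y₂, hy₂.2.2, ?_, h₁, h₂⟩
    simp [hne, hne', hx₂.1.symm, hx₂.2.1.symm, hy₂.1.symm, hy₂.2.1.symm]
  by_cases hlarge : k + 3 ≤ W.card
  · exact hC.exists_not_adj ((Finset.erase_subset _ _).trans (Finset.erase_subset _ _)) (by omega)
  · obtain ⟨x₂, hx₂, y₂, hy₂, hne', h₂⟩ := hC.exists_not_adj (Finset.erase_subset x₁ W) (by omega)
    have key : ∀ u ∈ W.erase x₁, u ≠ y₁ → G.Adj y₁ u := by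
      intro u hu huy
      by_contra hadj
      rw [Finset.mem_erase] at hu
      have := hC.card_add_le (T := {x₁, u}) hy₁ (by
        simp [hx₁, hne, hu.2, huy, hadj, G.adj_comm y₁ x₁, h₁])
      rw [Finset.card_pair hu.1.symm] at this
      omega
    refine ⟨x₂, Finset.mem_erase.2 ⟨?_, hx₂⟩, y₂, Finset.mem_erase.2 ⟨?_, hy₂⟩, hne', h₂⟩
    · rintro rfl
      exact h₂ (key y₂ hy₂ hne'.symm)
    · rintro rfl
      exact h₂ (key x₂ hx₂ hne').symm

lemma Critical.lt_card (hC : Critical G W L k) : k + 3 < W.card := by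
  by_contra! hle
  have hcard := hC.le_card
  have hk := hC.eight_le
  obtain ⟨x₁, mx₁, y₁, my₁, x₂, mx₂, y₂, my₂, hnd, h₁, h₂⟩ := hC.exists_two_pairs
  have hnd' := hnd
  simp only [List.nodup_cons, List.mem_cons, List.not_mem_nil, or_false, not_or,
    not_false_eq_true, List.nodup_nil, and_true] at hnd'
  obtain ⟨⟨n1, n2, n3⟩, ⟨n4, n5⟩, n6⟩ := hnd'
  set P : Finset V := {x₁, y₁, x₂, y₂} with hP
  have hPW : P ⊆ W := by
    intro v hv
    simp only [hP, Finset.mem_insert, Finset.mem_singleton] at hv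
    rcases hv with rfl | rfl | rfl | rfl <;> assumption
  have hPc : P.card = 4 := by
    rw [hP]; simp [n1, n2, n3, n4, n5, n6]
  have hbad : ∀ x ∈ P, ∀ y ∈ P, x ≠ y → ¬ G.Adj x y →
      ((W \ P) \ nbr G W x).card ≤ W.card - k - 2 := by
    intro x hx y hy hxy hadj
    have := hC.card_add_le (T := insert y ((W \ P) \ nbr G W x)) (hPW hx) (by
      intro u hu
      rcases Finset.mem_insert.1 hu with rfl | hu
      · exact ⟨hPW hy, hxy.symm, hadj⟩
      · simp only [Finset.mem_sdiff, mem_nbr, not_and] at hu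
        exact ⟨hu.1.1, fun h => hu.1.2 (h ▸ hx), hu.2 hu.1.1⟩)
    rw [Finset.card_insert_of_notMem (by simp [hy])] at this
    omega
  have px₁ : x₁ ∈ P := by simp [hP]
  have py₁ : y₁ ∈ P := by simp [hP]
  have px₂ : x₂ ∈ P := by simp [hP]
  have py₂ : y₂ ∈ P := by simp [hP]
  have hB : (P.biUnion fun x => (W \ P) \ nbr G W x).card ≤ 4 * (W.card - k - 2) := by
    rw [← hPc]
    refine Finset.card_biUnion_le_card_mul _ _ _ fun x hx => ?_
    have hx' := hx
    simp only [hP, Finset.mem_insert, Finset.mem_singleton] at hx'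
    rcases hx' with rfl | rfl | rfl | rfl
    · exact hbad _ hx _ py₁ n1 h₁
    · exact hbad _ hx _ px₁ (Ne.symm n1) fun h => h₁ h.symm
    · exact hbad _ hx _ py₂ n6 h₂
    · exact hbad _ hx _ px₂ (Ne.symm n6) fun h => h₂ h.symm
  have hZ : 2 < ((W \ P) \ P.biUnion fun x => (W \ P) \ nbr G W x).card := by
    have c1 := Finset.le_card_sdiff (P.biUnion fun x => (W \ P) \ nbr G W x) (W \ P)
    have c2 := Finset.card_sdiff_add_card_eq_card hPW
    omega
  have hZP : ∀ z ∈ (W \ P) \ P.biUnion (fun x => (W \ P) \ nbr G W x),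
      z ∈ W ∧ z ∉ P ∧ ∀ v ∈ P, G.Adj z v := by
    intro z hz
    obtain ⟨hz1, hz2⟩ := Finset.mem_sdiff.1 hz
    refine ⟨(Finset.mem_sdiff.1 hz1).1, (Finset.mem_sdiff.1 hz1).2, fun v hv => ?_⟩
    by_contra hadj
    refine hz2 (Finset.mem_biUnion.2 ⟨v, hv, Finset.mem_sdiff.2 ⟨hz1, fun h => hadj ?_⟩⟩)
    exact (mem_nbr.1 h).2.symm
  obtain ⟨z₁, z₂, z₃, hz₁, hz₂, hz₃, h12, h13, h23⟩ := Finset.two_lt_card_iff.1 hZ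
  have hchoice : ∃ z ∈ (W \ P) \ P.biUnion (fun x => (W \ P) \ nbr G W x), z ≠ z₁ ∧
      ((nbr G W z₁).erase z).card ≤ k := by
    have hz₁W := (hZP z₁ hz₁).1
    have hle := hC.nbr_le z₁ hz₁W
    by_cases ha : G.Adj z₁ z₂
    · refine ⟨z₂, hz₂, h12.symm, ?_⟩
      rw [Finset.card_erase_of_mem (mem_nbr.2 ⟨(hZP z₂ hz₂).1, ha⟩)]
      omega
    by_cases hb : G.Adj z₁ z₃
    · refine ⟨z₃, hz₃, h13.symm, ?_⟩
      rw [Finset.card_erase_of_mem (mem_nbr.2 ⟨(hZP z₃ hz₃).1, hb⟩)]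
      omega
    refine ⟨z₂, hz₂, h12.symm, (Finset.card_le_card (Finset.erase_subset _ _)).trans ?_⟩
    have := card_add_card_nbr_le (G := G) (T := {z₂, z₃}) hz₁W (by
      simp [ha, hb, (hZP z₂ hz₂).1, (hZP z₃ hz₃).1, h12.symm, h13.symm])
    rw [Finset.card_pair h23] at this
    omega
  obtain ⟨z, hz, hzz, hzc⟩ := hchoice
  obtain ⟨zW, zP, zadj⟩ := hZP z hz
  obtain ⟨zW', zP', zadj'⟩ := hZP z₁ hz₁
  have hzP := zP
  have hzP' := zP'
  simp only [hP, Finset.mem_insert, Finset.mem_singleton, not_or] at hzP hzP'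
  refine hC.not_colorable (colorableOn_of_uniform_lists (x₁ := x₁) (y₁ := y₁) (x₂ := x₂) (y₂ := y₂)
    (z := z) (z' := z₁) hk hC.card_list ?_ ?_ h₁ h₂ zadj (hC.nbr_le z zW) (zadj' _ px₁)
    (zadj' _ py₁) hzc ?_)
  · intro v hv
    simp only [Finset.mem_insert, Finset.mem_singleton] at hv
    rcases hv with rfl | rfl | rfl | rfl | rfl | rfl <;> assumption
  · simp only [List.nodup_cons, List.mem_cons, List.not_mem_nil, or_false, not_or,
      not_false_eq_true, List.nodup_nil, and_true]
    tauto
  · intro U hU hne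
    have hUW : U ⊆ W := hU.trans Finset.sdiff_subset
    have hzU : ∀ u ∈ U, u ≠ z ∧ u ≠ z₁ := by
      intro u hu
      have := (Finset.mem_sdiff.1 (hU hu)).2
      simp only [Finset.mem_insert, Finset.mem_singleton, not_or] at this
      tauto
    by_cases hex : ∃ u ∈ U, G.Adj u z ∧ G.Adj u z₁
    · obtain ⟨u, hu, ha, hb⟩ := hex
      refine ⟨u, hu, ?_⟩
      have h3 := card_nbr_add_le (X := W) (U := U ∪ P) (Finset.union_subset hUW hPW) zW zW' hzz
        (by simpa [zP] using fun h => (hzU z h).1 rfl)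
        (by simpa [zP'] using fun h => (hzU z₁ h).2 rfl) ha hb
      have := hC.nbr_le u (hUW hu)
      rw [← hP]
      omega
    · push Not at hex
      have hUc : U.card ≤ 4 := by
        have h1 := hC.card_add_le (T := U.filter fun u => u ∉ nbr G W z) zW (by
          intro u hu
          obtain ⟨hu, h⟩ := Finset.mem_filter.1 hu
          exact ⟨hUW hu, (hzU u hu).1, fun h' => h (mem_nbr.2 ⟨hUW hu, h'⟩)⟩)
        have h2 := hC.card_add_le (T := U.filter fun u => ¬ u ∉ nbr G W z) zW' (by
          intro u hu
          obtain ⟨hu, h⟩ := Finset.mem_filter.1 hu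
          rw [not_not] at h
          exact ⟨hUW hu, (hzU u hu).2, fun h' => hex u hu (mem_nbr.1 h).2.symm h'.symm⟩)
        have h3 := Finset.card_filter_add_card_filter_not (s := U) (fun u => u ∉ nbr G W z)
        omega
      obtain ⟨u, hu⟩ := hne
      refine ⟨u, hu, ?_⟩
      have h1 := Finset.card_le_card (nbr_subset_erase (G := G) (U ∪ P) u)
      rw [Finset.card_erase_of_mem (Finset.mem_union_left _ hu)] at h1
      have h2 := Finset.card_union_le U P
      rw [← hP]
      omega

end Critical

end ListColoring

section CircularModel

variable {V : Type*} {G : SimpleGraph V}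

/-- A cyclic enumeration `e` of `W`, with period `#W`, such that the neighbors of `e i` in `W` are
the `e j` with `j ≠ i` and `l i ≤ j ≤ r i`. -/
structure CircModel (G : SimpleGraph V) (W : Finset V) (e : ℤ → V) (l r : ℤ → ℤ) : Prop where
  mem : ∀ i, e i ∈ W
  surj : ∀ v ∈ W, ∀ a : ℤ, ∃ i, a ≤ i ∧ i < a + W.card ∧ e i = v
  le_of_eq : ∀ i j, e i = e j → i < j → i + W.card ≤ j
  period : ∀ i, e (i + W.card) = e i
  gc : ∀ i j, l j ≤ i ↔ j ≤ r i
  le_r : ∀ i, i ≤ r i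
  adj : ∀ i j, i < j → j ≤ r i → G.Adj (e i) (e j)
  exists_of_adj : ∀ i, ∀ v ∈ W, G.Adj (e i) v → ∃ j, e j = v ∧ l i ≤ j ∧ j ≤ r i

namespace CircModel

variable {W : Finset V} {L : V → Finset ℕ} {k : ℕ} {e : ℤ → V} {l r : ℤ → ℤ}

lemma translate (hM : CircModel G W e l r) (a : ℤ) :
    CircModel G W (fun i => e (i + a)) (fun i => l (i + a) - a) (fun i => r (i + a) - a) where
  mem i := hM.mem _
  surj v hv b := by
    obtain ⟨i, h1, h2, h3⟩ := hM.surj v hv (b + a)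
    exact ⟨i - a, by omega, by omega, by simpa using h3⟩
  le_of_eq i j h hij := by
    have := hM.le_of_eq _ _ h (by omega)
    omega
  period i := by
    rw [← hM.period (i + a), add_right_comm]
  gc i j := by
    have := hM.gc (i + a) (j + a)
    omega
  le_r i := by
    have := hM.le_r (i + a)
    omega
  adj i j hij h := hM.adj _ _ (by omega) (by omega)
  exists_of_adj i v hv h := by
    obtain ⟨j, h1, h2, h3⟩ := hM.exists_of_adj _ v hv h
    exact ⟨j - a, by simpa using h1, by omega, by omega⟩

lemma mirror (hM : CircModel G W e l r) (s : ℤ) :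
    CircModel G W (fun i => e (s - i)) (fun i => s - r (s - i)) (fun i => s - l (s - i)) where
  mem i := hM.mem _
  surj v hv b := by
    obtain ⟨i, h1, h2, h3⟩ := hM.surj v hv (s - b - W.card + 1)
    exact ⟨s - i, by omega, by omega, by simpa using h3⟩
  le_of_eq i j h hij := by
    have := hM.le_of_eq _ _ h.symm (by omega)
    omega
  period i := by
    rw [← hM.period (s - (i + W.card))]
    congr 1
    omega
  gc i j := by
    have := hM.gc (s - j) (s - i)
    omega
  le_r i := by
    have := hM.gc (s - i) (s - i)
    have := hM.le_r (s - i)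
    omega
  adj i j hij h := (hM.adj _ _ (by omega) ((hM.gc _ _).1 (by omega))).symm
  exists_of_adj i v hv h := by
    obtain ⟨j, h1, h2, h3⟩ := hM.exists_of_adj _ v hv h
    exact ⟨s - j, by simpa using h1, by omega, by omega⟩

lemma l_le (hM : CircModel G W e l r) (i : ℤ) : l i ≤ i := (hM.gc i i).2 (hM.le_r i)

lemma r_mono (hM : CircModel G W e l r) {i j : ℤ} (h : i ≤ j) : r i ≤ r j :=
  (hM.gc _ _).1 (((hM.gc i (r i)).2 le_rfl).trans h)

lemma l_mono (hM : CircModel G W e l r) {i j : ℤ} (h : i ≤ j) : l i ≤ l j :=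
  (hM.gc _ _).2 (h.trans ((hM.gc (l j) j).1 le_rfl))

lemma adj_of_mem (hM : CircModel G W e l r) {i j : ℤ} (hij : i ≠ j) (h1 : l i ≤ j)
    (h2 : j ≤ r i) : G.Adj (e i) (e j) := by
  rcases lt_or_gt_of_ne hij with h | h
  · exact hM.adj i j h h2
  · exact (hM.adj j i h ((hM.gc _ _).1 h1)).symm

lemma not_adj (hM : CircModel G W e l r) {i j : ℤ} (h1 : r i < j) (h2 : j < l i + W.card) :
    ¬ G.Adj (e i) (e j) := by
  intro h
  obtain ⟨j', h3, h4, h5⟩ := hM.exists_of_adj i _ (hM.mem j) h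
  have := hM.le_of_eq _ _ h3 (by omega)
  omega

lemma not_adj_left (hM : CircModel G W e l r) {i j : ℤ} (h1 : j < l i) (h2 : r i < j + W.card) :
    ¬ G.Adj (e i) (e j) := by
  rw [← hM.period j]
  exact hM.not_adj h2 (by omega)

lemma ne (hM : CircModel G W e l r) {i j : ℤ} (h : i ≠ j) (h1 : i < j + W.card)
    (h2 : j < i + W.card) : e i ≠ e j := by
  intro heq
  rcases lt_or_gt_of_ne h with h | h
  · have := hM.le_of_eq _ _ heq h
    omega
  · have := hM.le_of_eq _ _ heq.symm h
    omega

lemma nodup_map (hM : CircModel G W e l r) {a b : ℤ} (hb : b < a + W.card) {s : List ℤ}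
    (hs : ∀ i ∈ s, a ≤ i ∧ i ≤ b) (hnd : s.Nodup) : (s.map e).Nodup := by
  refine List.Nodup.map_on (fun i hi j hj h => ?_) hnd
  have h1 := hs i hi
  have h2 := hs j hj
  by_contra hne
  exact hM.ne hne (by omega) (by omega) h

/-- The interval `[1, t]` is a largest interval on which consecutive positions form a clique. -/
def IsMaxInterval (r : ℤ → ℤ) (t : ℤ) : Prop := r 1 = t ∧ ∀ i, r i < i + t

lemma isMaxInterval_mirror (hM : CircModel G W e l r) {t : ℤ} (ht : IsMaxInterval r t) :
    IsMaxInterval (fun i => t + 1 - l (t + 1 - i)) t := by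
  have hlt : ∀ i, i < l i + t := fun i => by
    have := ht.2 (l i)
    have := (hM.gc (l i) i).1 le_rfl
    omega
  refine ⟨?_, fun i => ?_⟩
  · have h1 := hlt t
    have h2 := (hM.gc 1 t).2 ht.1.ge
    simp only [add_sub_cancel_right]
    omega
  · have := hlt (t + 1 - i)
    dsimp only
    omega

variable [DecidableEq V]

lemma card_image (hM : CircModel G W e l r) {S : Finset ℤ} {a b : ℤ} (hS : S ⊆ Finset.Icc a b)
    (h : b < a + W.card) : (S.image e).card = S.card := by
  refine Finset.card_image_of_injOn fun i hi j hj hij => ?_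
  by_contra hne
  have h1 := Finset.mem_Icc.1 (hS hi)
  have h2 := Finset.mem_Icc.1 (hS hj)
  exact hM.ne hne (by omega) (by omega) hij

lemma r_lt (hM : CircModel G W e l r) (hC : Critical G W L k) (i : ℤ) : r i < i + k := by
  have hn := hC.le_card
  by_contra! hcon
  have h1 := hC.clique_le ((Finset.Icc i (i + k)).image e) (by
    intro v hv
    obtain ⟨j, -, rfl⟩ := Finset.mem_image.1 hv
    exact hM.mem j) (by
    intro u hu v hv huv
    obtain ⟨a, ha, rfl⟩ := Finset.mem_image.1 hu
    obtain ⟨b, hb, rfl⟩ := Finset.mem_image.1 hv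
    rw [Finset.mem_Icc] at ha hb
    have hab : a ≠ b := fun h => huv (by rw [h])
    have ra := hM.r_mono ha.1
    have rb := hM.r_mono hb.1
    rcases lt_or_gt_of_ne hab with h | h
    · exact hM.adj _ _ h (by omega)
    · exact (hM.adj _ _ h (by omega)).symm)
  rw [hM.card_image subset_rfl (by omega), Int.card_Icc] at h1
  omega

lemma lt_l (hM : CircModel G W e l r) (hC : Critical G W L k) (i : ℤ) : i < l i + k := by
  have := hM.r_lt hC (l i)
  have := (hM.gc (l i) i).1 le_rfl
  omega

lemma card_nbr_le (hM : CircModel G W e l r) (i : ℤ) : ((nbr G W (e i)).card : ℤ) ≤ r i - l i := by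
  have hl := hM.l_le i
  have hr := hM.le_r i
  have hsub : nbr G W (e i) ⊆ ((Finset.Icc (l i) (r i)).erase i).image e := by
    intro v hv
    obtain ⟨hv, hadj⟩ := mem_nbr.1 hv
    obtain ⟨j, rfl, h1, h2⟩ := hM.exists_of_adj i v hv hadj
    refine Finset.mem_image_of_mem _ (Finset.mem_erase.2 ⟨?_, Finset.mem_Icc.2 ⟨h1, h2⟩⟩)
    rintro rfl
    exact hadj.ne rfl
  have h1 := (Finset.card_le_card hsub).trans Finset.card_image_le
  rw [Finset.card_erase_of_mem (Finset.mem_Icc.2 ⟨hl, hr⟩), Int.card_Icc] at h1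
  omega

lemma le_card_nbr (hM : CircModel G W e l r) {a b c d i : ℤ} (hac : a ≤ c) (hdb : d ≤ b)
    (hci : c ≤ i) (hid : i ≤ d) (hl : l i ≤ c) (hr : d ≤ r i) (h : d < c + W.card) :
    d - c ≤ ((nbr G ((Finset.Icc a b).image e) (e i)).card : ℤ) := by
  have hsub : ((Finset.Icc c d).erase i).image e ⊆ nbr G ((Finset.Icc a b).image e) (e i) := by
    intro v hv
    obtain ⟨j, hj, rfl⟩ := Finset.mem_image.1 hv
    rw [Finset.mem_erase, Finset.mem_Icc] at hj
    refine mem_nbr.2 ⟨Finset.mem_image_of_mem _ (Finset.mem_Icc.2 (by omega)), ?_⟩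
    exact hM.adj_of_mem (Ne.symm hj.1) (by omega) (by omega)
  have h1 := Finset.card_le_card hsub
  rw [hM.card_image (Finset.erase_subset _ _) h,
    Finset.card_erase_of_mem (Finset.mem_Icc.2 ⟨hci, hid⟩), Int.card_Icc] at h1
  omega

lemma image_subset (hM : CircModel G W e l r) (S : Finset ℤ) : S.image e ⊆ W := by
  intro v hv
  obtain ⟨j, -, rfl⟩ := Finset.mem_image.1 hv
  exact hM.mem j

lemma le_sub (hM : CircModel G W e l r) (hC : Critical G W L k) (i : ℤ) : k ≤ r i - l i := by
  have := hC.le_nbr (hM.mem i)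
  have := hM.card_nbr_le i
  omega

lemma sub_le (hM : CircModel G W e l r) (hC : Critical G W L k) (i : ℤ) : r i - l i ≤ k + 1 := by
  have hn := hC.lt_card
  by_contra! hcon
  have h1 := hM.lt_l hC i
  have h2 := hM.l_le i
  have h3 := hM.le_card_nbr (a := l i) (b := l i + k + 2) (c := l i) (d := l i + k + 2) (i := i)
    le_rfl le_rfl h2 (by omega) le_rfl (by omega) (by omega)
  have h4 := Finset.card_le_card (nbr_mono (G := G)
    (hM.image_subset (Finset.Icc (l i) (l i + k + 2))) (e i))
  have h5 := hC.nbr_le _ (hM.mem i)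
  omega

lemma le_card_nbr_Icc (hM : CircModel G W e l r) {a b i : ℤ} (hb : b < a + W.card)
    (hi : a ≤ i ∧ i ≤ b) :
    min b (r i) - max a (l i) ≤ ((nbr G ((Finset.Icc a b).image e) (e i)).card : ℤ) := by
  have := hM.l_le i
  have := hM.le_r i
  exact hM.le_card_nbr (le_max_left _ _) (min_le_left _ _) (by omega) (by omega)
    (le_max_right _ _) (min_le_right _ _) (by omega)

lemma adj_of_mem_image (hM : CircModel G W e l r) {a b z : ℤ} (hz : l z ≤ a ∧ b ≤ r z) {v : V}
    (hv : v ∈ (Finset.Icc a b).image e) (hne : v ≠ e z) : G.Adj (e z) v := by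
  obtain ⟨j, hj, rfl⟩ := Finset.mem_image.1 hv
  rw [Finset.mem_Icc] at hj
  exact hM.adj_of_mem (fun h => hne (by rw [h])) (by omega) (by omega)

lemma card_image_Icc (hM : CircModel G W e l r) {a b : ℤ} (hab : a ≤ b) (hb : b < a + W.card) :
    (((Finset.Icc a b).image e).card : ℤ) = b - a + 1 := by
  rw [hM.card_image subset_rfl hb, Int.card_Icc]
  omega

/-- Two disjoint nonadjacent pairs of large degree sum and two universal vertices in an interval
contradict criticality. -/
lemma false_of_two_pairs (hM : CircModel G W e l r) (hC : Critical G W L k)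
    {a b x₁ y₁ x₂ y₂ z z' : ℤ} (hb : b < a + W.card)
    (hX : ∀ i ∈ [x₁, y₁, x₂, y₂, z, z'], a ≤ i ∧ i ≤ b) (hnd : [x₁, y₁, x₂, y₂, z, z'].Nodup)
    (h₁ : ¬ G.Adj (e x₁) (e y₁)) (h₂ : ¬ G.Adj (e x₂) (e y₂))
    (hz : l z ≤ a ∧ b ≤ r z) (hz' : l z' ≤ a ∧ b ≤ r z')
    (hs₁ : b - a + 3 ≤ min b (r x₁) - max a (l x₁) + (min b (r y₁) - max a (l y₁)))
    (hs₂ : b - a + 3 ≤ min b (r x₂) - max a (l x₂) + (min b (r y₂) - max a (l y₂))) : False := by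
  have hab : a ≤ b := by
    have := hX z (by simp)
    omega
  obtain ⟨L', hL', hnot⟩ := hC.residual (hM.image_subset (Finset.Icc a b))
    ⟨e a, Finset.mem_image_of_mem _ (Finset.mem_Icc.2 ⟨le_rfl, hab⟩)⟩
  have hcard := hM.card_image_Icc hab hb
  have d1 := hM.le_card_nbr_Icc hb (hX x₁ (by simp))
  have d2 := hM.le_card_nbr_Icc hb (hX y₁ (by simp))
  have d3 := hM.le_card_nbr_Icc hb (hX x₂ (by simp))
  have d4 := hM.le_card_nbr_Icc hb (hX y₂ (by simp))
  refine hnot (colorableOn_of_degree_sum (x₁ := e x₁) (y₁ := e y₁) (x₂ := e x₂) (y₂ := e y₂)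
    (z := e z) (z' := e z') ?_ (hM.nodup_map hb hX hnd) h₁ h₂ (fun v => hM.adj_of_mem_image hz)
    (fun v => hM.adj_of_mem_image hz') (by omega) (by omega) ?_)
  · intro v hv
    have : v ∈ ([x₁, y₁, x₂, y₂, z, z'].map e) := by simpa using hv
    obtain ⟨i, hi, rfl⟩ := List.mem_map.1 this
    exact Finset.mem_image_of_mem _ (Finset.mem_Icc.2 (hX i hi))
  · intro v hv
    have h1 := hL' v hv
    have h2 := hC.nbr_le v (hM.image_subset _ hv)
    omega

/-- A nonadjacent pair of large degree sum and two universal vertices, one of them of degree `k`,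
in an interval contradict criticality. -/
lemma false_of_pair (hM : CircModel G W e l r) (hC : Critical G W L k)
    {a b x y z z' : ℤ} (hb : b < a + W.card)
    (hX : ∀ i ∈ [x, y, z, z'], a ≤ i ∧ i ≤ b) (hnd : [x, y, z, z'].Nodup)
    (h : ¬ G.Adj (e x) (e y)) (hz : l z ≤ a ∧ b ≤ r z) (hz' : l z' ≤ a ∧ b ≤ r z')
    (hs : b - a + 3 ≤ min b (r x) - max a (l x) + (min b (r y) - max a (l y)))
    (hk : r z - l z ≤ k) : False := by
  have hab : a ≤ b := by
    have := hX z (by simp)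
    omega
  obtain ⟨L', hL', hnot⟩ := hC.residual (hM.image_subset (Finset.Icc a b))
    ⟨e a, Finset.mem_image_of_mem _ (Finset.mem_Icc.2 ⟨le_rfl, hab⟩)⟩
  have hcard := hM.card_image_Icc hab hb
  have d1 := hM.le_card_nbr_Icc hb (hX x (by simp))
  have d2 := hM.le_card_nbr_Icc hb (hX y (by simp))
  have hmem : ∀ i ∈ [x, y, z, z'], e i ∈ (Finset.Icc a b).image e := fun i hi =>
    Finset.mem_image_of_mem _ (Finset.mem_Icc.2 (hX i hi))
  have hnd' := hM.nodup_map hb hX hnd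
  simp only [List.map_cons, List.map_nil, List.nodup_cons, List.mem_cons, List.not_mem_nil,
    or_false, not_or, not_false_eq_true, List.nodup_nil, and_true] at hnd'
  obtain ⟨⟨n1, n2, n3⟩, ⟨n4, n5⟩, n6⟩ := hnd'
  refine hnot (colorableOn_of_degree_sum_of_large_list (hmem x (by simp)) (hmem y (by simp))
    (hmem z (by simp)) (hmem z' (by simp)) n1 n2 n3 n4 n5 n6 h (fun v => hM.adj_of_mem_image hz)
    (fun v => hM.adj_of_mem_image hz') (by omega) ?_ ?_)
  · intro v hv
    have h1 := hL' v hv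
    have h2 := hC.nbr_le v (hM.image_subset _ hv)
    omega
  · have h1 := hL' _ (hmem z (by simp))
    have h2 := hM.card_nbr_le z
    omega

/-- Two disjoint nonadjacent pairs near a short maximum interval clique contradict criticality. -/
lemma false_of_short (hM : CircModel G W e l r) (hC : Critical G W L k) {t x₁ y₁ x₂ y₂ : ℤ}
    (ht : t + 2 ≤ k) (hmax : ∀ i, r i < i + t)
    (hX : ∀ i ∈ [x₁, y₁, x₂, y₂, 3, 2], -1 ≤ i ∧ i ≤ t + 1)
    (hnd : [x₁, y₁, x₂, y₂, 3, 2].Nodup)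
    (h₁ : ¬ G.Adj (e x₁) (e y₁)) (h₂ : ¬ G.Adj (e x₂) (e y₂))
    (hz : ∀ i ∈ [x₁, y₁, x₂, y₂], l 3 ≤ i ∧ i ≤ r 3) (hzx : l 2 ≤ x₁ ∧ x₁ ≤ r 2)
    (hzy : l 2 ≤ y₁ ∧ y₁ ≤ r 2) (h23 : 3 ≤ r 2) : False := by
  have hn := hC.lt_card
  have hnd' := hM.nodup_map (by omega) hX hnd
  have hnd'' := hnd'
  simp only [List.map_cons, List.map_nil, List.nodup_cons, List.mem_cons, List.not_mem_nil,
    or_false, not_or, not_false_eq_true, List.nodup_nil, and_true] at hnd''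
  obtain ⟨⟨n1, n2, n3, n4, n5⟩, ⟨n6, n7, n8, n9⟩, ⟨n10, n11, n12⟩, ⟨n13, n14⟩, n15⟩ := hnd''
  set P : Finset V := {e x₁, e y₁, e x₂, e y₂} with hP
  have hPW : P ⊆ W := by
    intro v hv
    simp only [hP, Finset.mem_insert, Finset.mem_singleton] at hv
    rcases hv with rfl | rfl | rfl | rfl <;> exact hM.mem _
  have hzadj : ∀ v ∈ P, G.Adj (e 3) v := by
    intro v hv
    have hv' : v ∈ [x₁, y₁, x₂, y₂].map e := by simpa [hP] using hv
    obtain ⟨i, hi, rfl⟩ := List.mem_map.1 hv'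
    refine hM.adj_of_mem ?_ (hz i hi).1 (hz i hi).2
    rintro rfl
    simp at hnd hi
    tauto
  have hne2 : (2 : ℤ) ≠ x₁ ∧ (2 : ℤ) ≠ y₁ := by
    simp at hnd
    tauto
  have hpair : ∀ i x y, ¬ G.Adj (e x) (e y) →
      (({e x, e y} : Finset V) ∩ (Finset.Icc (i + 1) (r i)).image e).card ≤ 1 := by
    intro i x y hadj
    rw [Finset.card_le_one]
    intro u hu v hv
    by_contra huv
    simp only [Finset.mem_inter, Finset.mem_insert, Finset.mem_singleton] at hu hv
    have huv' : G.Adj u v := by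
      obtain ⟨a, ha, rfl⟩ := Finset.mem_image.1 hu.2
      rw [Finset.mem_Icc] at ha
      have h1 := hM.r_mono (show i ≤ a by omega)
      have h2 := (hM.gc i a).2 ha.2
      exact hM.adj_of_mem_image (a := i + 1) ⟨by omega, h1⟩ hv.2 (Ne.symm huv)
    rcases hu.1 with rfl | rfl <;> rcases hv.1 with rfl | rfl
    · exact huv rfl
    · exact hadj huv'
    · exact hadj huv'.symm
    · exact huv rfl
  refine hC.not_colorable (colorableOn_of_uniform_lists (x₁ := e x₁) (y₁ := e y₁) (x₂ := e x₂)
    (y₂ := e y₂) (z := e 3) (z' := e 2) hC.eight_le hC.card_list ?_ hnd' h₁ h₂ hzadj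
    (hC.nbr_le _ (hM.mem _)) (hM.adj_of_mem hne2.1 hzx.1 hzx.2) (hM.adj_of_mem hne2.2 hzy.1 hzy.2)
    ?_ ?_)
  · intro v hv
    simp only [Finset.mem_insert, Finset.mem_singleton] at hv
    rcases hv with rfl | rfl | rfl | rfl | rfl | rfl <;> exact hM.mem _
  · have h1 := hC.nbr_le _ (hM.mem 2)
    rw [Finset.card_erase_of_mem (mem_nbr.2 ⟨hM.mem 3, hM.adj 2 3 (by omega) h23⟩)]
    omega
  · rw [← hP]
    intro U hU hne
    have hUW : U ⊆ W := hU.trans Finset.sdiff_subset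
    have hnot : ∀ u ∈ U, u ≠ e 3 ∧ u ≠ e 2 := by
      intro u hu
      have := (Finset.mem_sdiff.1 (hU hu)).2
      simp only [Finset.mem_insert, Finset.mem_singleton, not_or] at this
      tauto
    have hpos : ∀ v, ∃ i : ℤ, v ∈ U → 4 ≤ i ∧ i < 2 + W.card ∧ e i = v := by
      intro v
      by_cases hv : v ∈ U
      · obtain ⟨i, h1, h2, h3⟩ := hM.surj v (hUW hv) 4
        refine ⟨i, fun _ => ⟨h1, ?_, h3⟩⟩
        obtain ⟨ne3, ne2⟩ := hnot v hv
        by_contra! hge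
        obtain rfl | rfl : i = 2 + W.card ∨ i = 3 + W.card := by omega
        · exact ne2 (by rw [← h3, hM.period])
        · exact ne3 (by rw [← h3, hM.period])
      · exact ⟨0, fun h => absurd h hv⟩
    choose pos hpos using hpos
    obtain ⟨u, hu, hmaxu⟩ := Finset.exists_max_image U pos hne
    obtain ⟨hi4, hin, hiu⟩ := hpos u hu
    set i := pos u with hi
    refine ⟨u, hu, ?_⟩
    rw [← hiu]
    by_cases hr : 3 + W.card ≤ r i
    · have ha : G.Adj (e i) (e 3) := by
        rw [← hM.period 3]
        exact hM.adj _ _ (by omega) hr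
      have hb : G.Adj (e i) (e 2) := by
        rw [← hM.period 2]
        exact hM.adj _ _ (by omega) (by omega)
      have h3 := card_nbr_add_le (X := W) (U := U ∪ P) (Finset.union_subset hUW hPW) (hM.mem 3)
        (hM.mem 2) n15
        (by
          rw [Finset.mem_union, not_or]
          exact ⟨fun h => (hnot _ h).1 rfl, fun h => (hzadj _ h).ne rfl⟩)
        (by
          rw [Finset.mem_union, not_or]
          refine ⟨fun h => (hnot _ h).2 rfl, fun h => ?_⟩
          simp only [hP, Finset.mem_insert, Finset.mem_singleton] at h
          tauto) ha hb
      have := hC.nbr_le _ (hM.mem i)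
      omega
    · have hsub : nbr G (U ∪ P) (e i) ⊆ (Finset.Icc (l i) (i - 1)).image e ∪
          (({e x₁, e y₁} : Finset V) ∩ (Finset.Icc (i + 1) (r i)).image e ∪
            ({e x₂, e y₂} : Finset V) ∩ (Finset.Icc (i + 1) (r i)).image e) := by
        intro v hv
        obtain ⟨hvUP, hadj⟩ := mem_nbr.1 hv
        obtain ⟨j, rfl, h1, h2⟩ := hM.exists_of_adj i v ((Finset.union_subset hUW hPW) hvUP) hadj
        rcases lt_trichotomy j i with hlt | rfl | hgt
        · exact Finset.mem_union_left _
            (Finset.mem_image_of_mem _ (Finset.mem_Icc.2 ⟨h1, by omega⟩))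
        · exact absurd rfl hadj.ne
        · have hmem : e j ∈ (Finset.Icc (i + 1) (r i)).image e :=
            Finset.mem_image_of_mem _ (Finset.mem_Icc.2 ⟨by omega, h2⟩)
          rcases Finset.mem_union.1 hvUP with hvU | hvP
          · obtain ⟨p1, p2, p3⟩ := hpos _ hvU
            have hle := hmaxu _ hvU
            exact absurd p3 (hM.ne (by omega) (by omega) (by omega))
          · simp only [hP, Finset.mem_insert, Finset.mem_singleton] at hvP
            simp only [Finset.mem_union, Finset.mem_inter, Finset.mem_insert,
              Finset.mem_singleton]
            tauto
      have c1 := Finset.card_le_card hsub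
      have c2 := Finset.card_union_le ((Finset.Icc (l i) (i - 1)).image e)
        (({e x₁, e y₁} : Finset V) ∩ (Finset.Icc (i + 1) (r i)).image e ∪
            ({e x₂, e y₂} : Finset V) ∩ (Finset.Icc (i + 1) (r i)).image e)
      have c3 := Finset.card_union_le
        (({e x₁, e y₁} : Finset V) ∩ (Finset.Icc (i + 1) (r i)).image e)
        (({e x₂, e y₂} : Finset V) ∩ (Finset.Icc (i + 1) (r i)).image e)
      have c4 := hpair i _ _ h₁
      have c5 := hpair i _ _ h₂
      have c6 : ((Finset.Icc (l i) (i - 1)).image e).card ≤ _ := Finset.card_image_le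
      rw [Int.card_Icc] at c6
      have c7 := hmax (l i)
      have c8 := (hM.gc (l i) i).1 le_rfl
      have c9 := hM.l_le i
      omega

lemma false_of_short_of_le (hM : CircModel G W e l r) (hC : Critical G W L k) {t : ℤ}
    (ht : IsMaxInterval r t) (htk : t + 2 ≤ k) (h3 : l 3 ≤ 0) : False := by
  obtain ⟨hr1, hmax⟩ := ht
  have hn := hC.lt_card
  have hk := hC.eight_le
  have h0 : 3 ≤ r 0 := (hM.gc 0 3).1 h3
  have m0 := hmax 0
  have s0 := hM.sub_le hC 0
  have hr2 := hM.r_mono (show (1 : ℤ) ≤ 2 by omega)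
  have hr3 := hM.r_mono (show (2 : ℤ) ≤ 3 by omega)
  have hl2 := hM.l_mono (show (2 : ℤ) ≤ 3 by omega)
  have d3 := hM.le_sub hC 3
  have s1 := hM.sub_le hC 1
  have nadj : ¬ G.Adj (e 0) (e (r 0 + 1)) := hM.not_adj (by omega) (by omega)
  by_cases hl3 : l 3 ≤ -1
  · have hm1 : 3 ≤ r (-1) := (hM.gc (-1) 3).1 hl3
    have mm1 := hmax (-1)
    have sm1 := hM.sub_le hC (-1)
    have mono := hM.r_mono (show (-1 : ℤ) ≤ 0 by omega)
    obtain ⟨y, hy1, hy2, hy3⟩ : ∃ y, r (-1) < y ∧ y ≤ r (-1) + 2 ∧ y ≠ r 0 + 1 ∧ y ≤ t := by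
      by_cases h : r (-1) < r 0
      · exact ⟨r (-1) + 1, by omega, by omega, by omega, by omega⟩
      · exact ⟨r (-1) + 2, by omega, by omega, by omega, by omega⟩
    refine hM.false_of_short hC htk hmax (x₁ := 0) (y₁ := r 0 + 1) (x₂ := -1) (y₂ := y) ?_ ?_
      nadj (hM.not_adj hy1 (by omega)) ?_ (by omega) (by omega) (by omega)
    · intro i hi
      simp only [List.mem_cons, List.not_mem_nil, or_false] at hi
      omega
    · simp only [List.nodup_cons, List.mem_cons, List.not_mem_nil, or_false, not_or,
        not_false_eq_true, List.nodup_nil, and_true]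
      omega
    · intro i hi
      simp only [List.mem_cons, List.not_mem_nil, or_false] at hi
      omega
  · refine hM.false_of_short hC htk hmax (x₁ := 0) (y₁ := r 0 + 1) (x₂ := 1) (y₂ := t + 1) ?_ ?_
      nadj (hM.not_adj (by omega) (by omega)) ?_ (by omega) (by omega) (by omega)
    · intro i hi
      simp only [List.mem_cons, List.not_mem_nil, or_false] at hi
      omega
    · simp only [List.nodup_cons, List.mem_cons, List.not_mem_nil, or_false, not_or,
        not_false_eq_true, List.nodup_nil, and_true]
      omega
    · intro i hi
      simp only [List.mem_cons, List.not_mem_nil, or_false] at hi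
      omega

lemma le_of_isMaxInterval (hM : CircModel G W e l r) (hC : Critical G W L k) {t : ℤ}
    (ht : IsMaxInterval r t) : k ≤ t + 1 := by
  have hk := hC.eight_le
  by_contra! htk
  have d3 := hM.le_sub hC 3
  have m3 := ht.2 3
  have ml3 := ht.2 (l 3)
  have hg := (hM.gc (l 3) 3).1 le_rfl
  by_cases hl3 : l 3 ≤ 0
  · exact hM.false_of_short_of_le hC ht (by omega) hl3
  · have hM' := hM.mirror (t + 1)
    have mono := hM'.l_mono (show 3 ≤ t - 2 by omega)
    refine hM'.false_of_short_of_le hC (hM.isMaxInterval_mirror ht) (by omega) (mono.trans ?_)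
    have : t + 1 - (t - 2) = 3 := by omega
    simp only [this]
    omega

lemma false_of_l_four_neg (hM : CircModel G W e l r) (hC : Critical G W L k) {t : ℤ}
    (ht : IsMaxInterval r t) (h4 : l 4 ≤ -1) : False := by
  have htk := hM.le_of_isMaxInterval hC ht
  obtain ⟨hr1, hmax⟩ := ht
  have hn := hC.lt_card
  have hk := hC.eight_le
  have htk' := hM.r_lt hC 1
  have h0 : 4 ≤ r 0 := (hM.gc 0 4).1 (by omega)
  have hm1 : 4 ≤ r (-1) := (hM.gc (-1) 4).1 h4
  have m0 := hmax 0
  have s0 := hM.sub_le hC 0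
  have mm1 := hmax (-1)
  have sm1 := hM.sub_le hC (-1)
  have hr3 := hM.r_mono (show (1 : ℤ) ≤ 3 by omega)
  have hr4 := hM.r_mono (show (1 : ℤ) ≤ 4 by omega)
  have hl3 := hM.l_mono (show (3 : ℤ) ≤ 4 by omega)
  have hl0 := hM.l_mono (show (0 : ℤ) ≤ 4 by omega)
  have hlm := hM.l_le (-1)
  have mono := hM.r_mono (show (-1 : ℤ) ≤ 0 by omega)
  have hdeg : ∀ y, 1 ≤ y → y ≤ t → l y ≤ 1 ∧ t ≤ r y := fun y h1 h2 =>
    ⟨(hM.gc 1 y).2 (by omega), by have := hM.r_mono h1; omega⟩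
  obtain ⟨y, hy1, hy2, hy3⟩ : ∃ y, r (-1) < y ∧ y ≤ r (-1) + 2 ∧ y ≠ r 0 + 1 ∧ y ≤ t := by
    by_cases h : r (-1) < r 0
    · exact ⟨r (-1) + 1, by omega, by omega, by omega, by omega⟩
    · exact ⟨r (-1) + 2, by omega, by omega, by omega, by omega⟩
  have d1 := hdeg (r 0 + 1) (by omega) (by omega)
  have d2 := hdeg y (by omega) (by omega)
  refine hM.false_of_two_pairs hC (a := -1) (b := t) (x₁ := 0) (y₁ := r 0 + 1) (x₂ := -1)
    (y₂ := y) (z := 4) (z' := 3) (by omega) ?_ ?_ (hM.not_adj (by omega) (by omega))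
    (hM.not_adj hy1 (by omega)) (by omega) (by omega) (by omega) (by omega)
  · intro i hi
    simp only [List.mem_cons, List.not_mem_nil, or_false] at hi
    omega
  · simp only [List.nodup_cons, List.mem_cons, List.not_mem_nil, or_false, not_or,
      not_false_eq_true, List.nodup_nil, and_true]
    omega

lemma false_of_l_nonpos (hM : CircModel G W e l r) (hC : Critical G W L k) {t m : ℤ}
    (ht : IsMaxInterval r t) (hm : 4 ≤ m) (hl : l m ≤ 0) (hmk : r m - l m ≤ k) : False := by
  obtain ⟨hr1, hmax⟩ := ht
  have hn := hC.lt_card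
  have htk' := hM.r_lt hC 1
  have h0 : m ≤ r 0 := (hM.gc 0 m).1 hl
  have m0 := hmax 0
  have s0 := hM.sub_le hC 0
  have hrm := hM.r_mono (show (1 : ℤ) ≤ m by omega)
  have hrm' := hM.r_mono (show (1 : ℤ) ≤ m - 1 by omega)
  have hlm' := hM.l_mono (show m - 1 ≤ m by omega)
  have hl0 := hM.l_le 0
  have d1 := (hM.gc 1 (r 0 + 1)).2 (by omega)
  have d2 := hM.r_mono (show 1 ≤ r 0 + 1 by omega)
  refine hM.false_of_pair hC (a := 0) (b := t) (x := 0) (y := r 0 + 1) (z := m) (z' := m - 1)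
    (by omega) ?_ ?_ (hM.not_adj (by omega) (by omega)) (by omega) (by omega) (by omega) hmk
  · intro i hi
    simp only [List.mem_cons, List.not_mem_nil, or_false] at hi
    omega
  · simp only [List.nodup_cons, List.mem_cons, List.not_mem_nil, or_false, not_or,
      not_false_eq_true, List.nodup_nil, and_true]
    omega

lemma r_le_of_isMaxInterval (hM : CircModel G W e l r) (hC : Critical G W L k) {t m : ℤ}
    (ht : IsMaxInterval r t) (hm : m + 3 ≤ t) : r m ≤ t + 1 := by
  by_contra! hr
  have hM' := hM.mirror (t + 1)
  have mono := hM'.l_mono (show 4 ≤ t + 1 - m by omega)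
  refine hM'.false_of_l_four_neg hC (hM.isMaxInterval_mirror ht) (mono.trans ?_)
  simp only [sub_sub_cancel]
  omega

lemma false_of_lt_r (hM : CircModel G W e l r) (hC : Critical G W L k) {t m : ℤ}
    (ht : IsMaxInterval r t) (hm : m + 3 ≤ t) (hr : t < r m) (hmk : r m - l m ≤ k) : False := by
  refine (hM.mirror (t + 1)).false_of_l_nonpos hC (hM.isMaxInterval_mirror ht)
    (show 4 ≤ t + 1 - m by omega) ?_ ?_ <;> simp only [sub_sub_cancel] <;> omega

lemma not_isMaxInterval (hM : CircModel G W e l r) (hC : Critical G W L k) {t : ℤ} :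
    ¬ IsMaxInterval r t := by
  intro ht
  have htk := hM.le_of_isMaxInterval hC ht
  have hk := hC.eight_le
  have hn := hC.lt_card
  have htk' := hM.r_lt hC 1
  have r4 := hM.r_le_of_isMaxInterval hC ht (show 4 + 3 ≤ t by omega)
  have d4 := hM.le_sub hC 4
  have d5 := hM.le_sub hC 5
  have s4 := hM.sub_le hC 4
  have l4 : 0 ≤ l 4 := by
    by_contra! h
    exact hM.false_of_l_four_neg hC ht (by omega)
  have hr1 := ht.1
  by_cases h4 : r 4 - l 4 ≤ k
  · by_cases h : l 4 ≤ 0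
    · exact hM.false_of_l_nonpos hC ht le_rfl h h4
    · exact hM.false_of_lt_r hC ht (show 4 + 3 ≤ t by omega) (by omega) h4
  have r5 := hM.r_le_of_isMaxInterval hC ht (show 5 + 3 ≤ t by omega)
  have mono := hM.r_mono (show (4 : ℤ) ≤ 5 by omega)
  by_cases h5 : l 5 ≤ 0
  · have h0 : 5 ≤ r 0 := (hM.gc 0 5).1 h5
    have m0 := ht.2 0
    have s0 := hM.sub_le hC 0
    have lt4 : l (t + 1) ≤ 4 := (hM.gc _ _).2 (by omega)
    have lt2 : 1 < l (t + 1) := by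
      by_contra! h
      have := (hM.gc _ _).1 h
      omega
    have st := hM.sub_le hC (t + 1)
    have rt := hM.le_r (t + 1)
    have l0 := hM.l_le 0
    have y1r := hM.r_mono (show 4 ≤ r 0 + 1 by omega)
    have y1l := (hM.gc 1 (r 0 + 1)).2 (by omega)
    have y2r := hM.r_mono (show 1 ≤ l (t + 1) - 1 by omega)
    have y2l := hM.l_mono (show l (t + 1) - 1 ≤ 4 by omega)
    refine hM.false_of_two_pairs hC (a := 0) (b := t + 1) (x₁ := 0) (y₁ := r 0 + 1) (x₂ := t + 1)
      (y₂ := l (t + 1) - 1) (z := 4) (z' := 5) (by omega) ?_ ?_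
      (hM.not_adj (by omega) (by omega)) (hM.not_adj_left (by omega) (by omega)) (by omega)
      (by omega) (by omega) (by omega)
    · intro i hi
      simp only [List.mem_cons, List.not_mem_nil, or_false] at hi
      omega
    · simp only [List.nodup_cons, List.mem_cons, List.not_mem_nil, or_false, not_or,
        not_false_eq_true, List.nodup_nil, and_true]
      omega
  · exact hM.false_of_lt_r hC ht (show 5 + 3 ≤ t by omega) (by omega) (by omega)

theorem not_critical (hM : CircModel G W e l r) : ¬ Critical G W L k := by
  intro hC
  obtain ⟨t, ⟨i₀, hi₀⟩, hmax⟩ := Int.exists_greatest_of_bdd (P := fun t => ∃ i, r i - i + 1 = t)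
    ⟨k, by
      rintro t ⟨i, rfl⟩
      have := hM.r_lt hC i
      omega⟩ ⟨_, 0, rfl⟩
  refine (hM.translate (i₀ - 1)).not_isMaxInterval hC (t := t) ⟨?_, fun i => ?_⟩
  · have : 1 + (i₀ - 1) = i₀ := by omega
    simp only [this]
    omega
  · have := hmax _ ⟨i + (i₀ - 1), rfl⟩
    dsimp only
    omega

end CircModel

end CircularModel

section Construction

variable {V : Type*} {G : SimpleGraph V} {W : Finset V} {L : V → Finset ℕ} {k : ℕ}

/-- A cyclic enumeration whose adjacency is governed by a relation closed under passing to
subintervals yields a `CircModel`. -/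
lemma exists_circModel_of_rel (hC : Critical G W L k) (hk : k < W.card) {e : ℤ → V}
    {R : ℤ → ℤ → Prop} (hmem : ∀ i, e i ∈ W)
    (hsurj : ∀ v ∈ W, ∀ a : ℤ, ∃ i, a ≤ i ∧ i < a + W.card ∧ e i = v)
    (hle : ∀ i j, e i = e j → i < j → i + W.card ≤ j) (hper : ∀ i, e (i + W.card) = e i)
    (hsub : ∀ i i' j' j, i ≤ i' → i' ≤ j' → j' ≤ j → R i j → R i' j')
    (hadj : ∀ i j, i < j → R i j → e i ≠ e j → G.Adj (e i) (e j))
    (hex : ∀ i, ∀ v ∈ W, G.Adj (e i) v → ∃ j, e j = v ∧ (i ≤ j ∧ R i j ∨ j ≤ i ∧ R j i)) :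
    ∃ l r, CircModel G W e l r := by
  have hbd : ∀ i j, R i j → j < i + W.card := by
    intro i j hR
    by_contra! hij
    refine absurd (hC.clique_le W subset_rfl fun u hu v hv huv => ?_) (by omega)
    obtain ⟨a, ha, ha', rfl⟩ := hsurj u hu i
    obtain ⟨b, hb, hb', rfl⟩ := hsurj v hv i
    rcases lt_trichotomy a b with h | rfl | h
    · exact hadj a b h (hsub i a b j ha h.le (by omega) hR) huv
    · exact absurd rfl huv
    · exact (hadj b a h (hsub i b a j hb h.le (by omega) hR) huv.symm).symm
  have hr : ∀ i, ∃ j, (i ≤ j ∧ (i = j ∨ R i j)) ∧ ∀ j', (i ≤ j' ∧ (i = j' ∨ R i j')) → j' ≤ j := by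
    intro i
    refine Int.exists_greatest_of_bdd ⟨i + W.card, ?_⟩ ⟨i, le_rfl, Or.inl rfl⟩
    rintro j ⟨-, rfl | h⟩
    · omega
    · exact (hbd _ _ h).le
  choose r hr hrmax using hr
  have hrn : ∀ i, r i < i + W.card := by
    intro i
    rcases (hr i).2 with h | h
    · omega
    · exact hbd _ _ h
  have hmono : ∀ i j, i ≤ j → r i ≤ r j := by
    intro i j hij
    by_cases h : j ≤ r i
    · refine hrmax j _ ⟨h, ?_⟩
      rcases (hr i).2 with h' | h'
      · exact Or.inl (by omega)
      · exact Or.inr (hsub i j _ _ hij h le_rfl h')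
    · have := (hr j).1
      omega
  have hl : ∀ j, ∃ i, j ≤ r i ∧ ∀ i', j ≤ r i' → i ≤ i' := by
    intro j
    refine Int.exists_least_of_bdd ⟨j - W.card, fun i hi => ?_⟩ ⟨j, (hr j).1⟩
    have := hrn i
    omega
  choose l hl hlmin using hl
  have hgc : ∀ i j, l j ≤ i ↔ j ≤ r i := fun i j =>
    ⟨fun h => (hl j).trans (hmono _ _ h), hlmin j i⟩
  refine ⟨l, r, hmem, hsurj, hle, hper, hgc, fun i => (hr i).1, fun i j hij hj => ?_,
    fun i v hv h => ?_⟩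
  · have hR : R i j := by
      rcases (hr i).2 with h | h
      · omega
      · exact hsub i i j _ le_rfl hij.le hj h
    refine hadj i j hij hR fun h => ?_
    have := hle i j h hij
    have := hbd i j hR
    omega
  · obtain ⟨j, rfl, ⟨h1, h2⟩ | ⟨h1, h2⟩⟩ := hex i v hv h
    · have := (hgc i i).2 (hr i).1
      exact ⟨j, rfl, by omega, hrmax i j ⟨h1, Or.inr h2⟩⟩
    · have := (hr i).1
      exact ⟨j, rfl, (hgc j i).2 (hrmax j i ⟨h1, Or.inr h2⟩), by omega⟩

/-- Finitely many points of the circle, enumerated cyclically through the line. -/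
lemma exists_cyclic_enumeration {p : V → AddCircle (1 : ℝ)} (hp : Function.Injective p)
    (hW : 0 < W.card) : ∃ (e : ℤ → V) (y : ℤ → ℝ), StrictMono y ∧ (∀ i, e i ∈ W) ∧
      (∀ i, p (e i) = (y i : AddCircle (1 : ℝ))) ∧ (∀ i, y (i + W.card) = y i + 1) ∧
      (∀ i, e (i + W.card) = e i) ∧
      ∀ v ∈ W, ∀ s : ℝ, p v = (s : AddCircle (1 : ℝ)) → ∃ i, y i = s ∧ e i = v := by
  classical
  set n := W.card with hn
  have hrep : ∀ v, ∃ s : ℝ, s ∈ Set.Ico (0 : ℝ) 1 ∧ (s : AddCircle (1 : ℝ)) = p v := by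
    intro v
    obtain ⟨s, hs, hs'⟩ := AddCircle.eq_coe_Ico (p v)
    exact ⟨s, hs, hs'⟩
  choose rep hrep hrepp using hrep
  have hinj : Function.Injective rep := fun u v h => hp (by rw [← hrepp, ← hrepp, h])
  have hcard : (W.image rep).card = n := Finset.card_image_of_injective _ hinj
  set x := (W.image rep).orderEmbOfFin hcard with hx
  have hf : ∀ i : Fin n, ∃ v ∈ W, rep v = x i := fun i =>
    Finset.mem_image.1 (Finset.orderEmbOfFin_mem _ hcard i)
  choose f hfW hfx using hf
  have hnz : (0 : ℤ) < n := by omega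
  let m : ℤ → Fin n := fun i => ⟨(i % n).toNat, by
    have := Int.emod_lt_of_pos i hnz
    have := Int.emod_nonneg i hnz.ne'
    omega⟩
  have hmper : ∀ i, m (i + n) = m i := fun i => by simp [m]
  have hx0 : ∀ i, 0 ≤ x i ∧ x i < 1 := fun i => by
    rw [← hfx]
    exact hrep _
  have hsurj : ∀ v ∈ W, ∃ i : Fin n, f i = v := by
    intro v hv
    have : rep v ∈ Set.range x := by
      rw [hx, Finset.range_orderEmbOfFin]
      exact Finset.mem_coe.2 (Finset.mem_image_of_mem _ hv)
    obtain ⟨i, hi⟩ := this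
    exact ⟨i, hinj ((hfx i).trans hi)⟩
  refine ⟨fun i => f (m i), fun i => x (m i) + (i / n : ℤ), ?_, fun i => hfW _, fun i => ?_,
    fun i => ?_, fun i => by simp only [hmper], fun v hv s hs => ?_⟩
  · intro i j hij
    dsimp only
    have hdiv : i / n ≤ j / n := Int.ediv_le_ediv hnz hij.le
    rcases hdiv.eq_or_lt with h | h
    · have h1 := Int.emod_add_mul_ediv i n
      have h2 := Int.emod_add_mul_ediv j n
      rw [h] at h1 ⊢
      have : x (m i) < x (m j) := by
        refine x.strictMono (Fin.mk_lt_mk.2 ?_)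
        have := Int.emod_nonneg i hnz.ne'
        omega
      linarith
    · have h1 := (hx0 (m i)).2
      have h2 := (hx0 (m j)).1
      have h3 : ((i / n : ℤ) : ℝ) + 1 ≤ (j / n : ℤ) := by exact_mod_cast h
      linarith
  · have h0 : (((i / n : ℤ) : ℝ) : AddCircle (1 : ℝ)) = 0 :=
      (AddCircle.coe_eq_zero_iff _).2 ⟨_, zsmul_one _⟩
    rw [← hrepp, hfx, AddCircle.coe_add, h0, add_zero]
  · dsimp only
    rw [hmper, Int.add_ediv_of_dvd_right dvd_rfl, Int.ediv_self hnz.ne']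
    push_cast
    ring
  · obtain ⟨a, rfl⟩ := hsurj v hv
    have h0 : ((s - x a : ℝ) : AddCircle (1 : ℝ)) = 0 := by
      rw [AddCircle.coe_sub, ← hs, ← hrepp, hfx, sub_self]
    obtain ⟨q, hq⟩ := (AddCircle.coe_eq_zero_iff _).1 h0
    rw [zsmul_one] at hq
    have ha := a.2
    have hdiv : ((a : ℤ) + n * q) / n = q := by
      rw [Int.add_mul_ediv_left _ _ hnz.ne', Int.ediv_eq_zero_of_lt (by omega) (by omega),
        zero_add]
    have hm : m (a + n * q) = a := by
      ext
      simp only [m, Int.add_mul_emod_self_left]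
      rw [Int.emod_eq_of_lt (by omega) (by omega), Int.toNat_natCast]
    refine ⟨a + n * q, ?_, ?_⟩
    · dsimp only
      rw [hm, hdiv]
      linarith
    · dsimp only
      rw [hm]

theorem exists_circModel (hci : IsCircularInterval G) (hC : Critical G W L k) (hk : k < W.card) :
    ∃ e l r, CircModel G W e l r := by
  obtain ⟨p, C, hp, hadj⟩ := hci
  obtain ⟨e, y, hy, hmem, hpy, hy1, hper, hlift⟩ := exists_cyclic_enumeration hp (k.zero_le.trans_lt hk)
  refine ⟨e, exists_circModel_of_rel hC hk
    (R := fun i j => ∃ c ∈ C, ∃ α : ℝ, (α : AddCircle (1 : ℝ)) = c.1 ∧ α ≤ y i ∧ y j ≤ α + c.2)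
    hmem (fun v hv a => ?_) (fun i j h hij => ?_) hper ?_ ?_ ?_⟩
  · have hv' : p v ∈ ((↑) : ℝ → AddCircle (1 : ℝ)) '' Set.Ico (y a) (y a + 1) := by
      rw [AddCircle.coe_image_Ico_eq]
      trivial
    obtain ⟨s, ⟨hs1, hs2⟩, hs⟩ := hv'
    obtain ⟨i, rfl, hi⟩ := hlift v hv s hs.symm
    rw [← hy1] at hs2
    exact ⟨i, hy.le_iff_le.1 hs1, hy.lt_iff_lt.1 hs2, hi⟩
  · have h0 : ((y j - y i : ℝ) : AddCircle (1 : ℝ)) = 0 := by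
      rw [AddCircle.coe_sub, ← hpy, ← hpy, h, sub_self]
    obtain ⟨q, hq⟩ := (AddCircle.coe_eq_zero_iff _).1 h0
    rw [zsmul_one] at hq
    have hlt := hy hij
    have hq1 : (1 : ℝ) ≤ q := by
      have : (0 : ℝ) < q := by linarith
      exact_mod_cast this
    rw [← hy.le_iff_le, hy1]
    linarith
  · rintro i i' j' j hi - hj ⟨c, hc, α, hα, h1, h2⟩
    exact ⟨c, hc, α, hα, h1.trans (hy.monotone hi), (hy.monotone hj).trans h2⟩
  · rintro i j hij ⟨c, hc, α, hα, h1, h2⟩ hne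
    have hij' := hy hij
    refine (hadj _ _).2 ⟨hne, c, hc, ⟨y i - α, by linarith, by linarith, ?_⟩,
      ⟨y j - α, by linarith, by linarith, ?_⟩⟩
    · rw [hpy, ← hα, AddCircle.coe_sub, add_sub_cancel]
    · rw [hpy, ← hα, AddCircle.coe_sub, add_sub_cancel]
  · intro i v hv h
    obtain ⟨-, c, hc, ⟨s, hs0, hs1, hs⟩, ⟨s', hs0', hs1', hs'⟩⟩ := (hadj _ _).1 h
    have hα : ((y i - s : ℝ) : AddCircle (1 : ℝ)) = c.1 := by
      rw [AddCircle.coe_sub, ← hpy, hs, add_sub_cancel_right]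
    obtain ⟨j, hj, rfl⟩ := hlift v hv (y i - s + s') (by rw [hs', AddCircle.coe_add, hα])
    refine ⟨j, rfl, ?_⟩
    rcases le_total i j with hij | hij
    · exact Or.inl ⟨hij, c, hc, y i - s, hα, by linarith, by linarith⟩
    · exact Or.inr ⟨hij, c, hc, y i - s, hα, by linarith, by linarith⟩

end Construction

lemma card_nbr_le_maxDeg {V : Type*} [Finite V] (G : SimpleGraph V) (W : Finset V) (v : V) :
    (nbr G W v).card ≤ maxDeg G := by
  refine le_trans ?_ (le_csSup (Set.finite_range (deg G)).bddAbove ⟨v, rfl⟩)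
  rw [deg, ← Set.ncard_coe_finset]
  exact Set.ncard_le_ncard (fun u hu => (mem_nbr.1 (Finset.mem_coe.1 hu)).2) (Set.toFinite _)

/-- Every circular interval graph with `χ_ℓ ≥ Δ ≥ 9` contains a `K_Δ`. -/
theorem stmt7 {V : Type*} [Fintype V] (G : SimpleGraph V)
    (hci : IsCircularInterval G)
    (hχ : maxDeg G ≤ listChromNum G) (hΔ : 9 ≤ maxDeg G) :
    ∃ S : Finset V, G.IsNClique (maxDeg G) S := by
  classical
  by_contra! hno
  obtain ⟨k, hk⟩ : ∃ k, maxDeg G = k + 1 := ⟨maxDeg G - 1, by omega⟩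
  suffices H : ∀ L : V → Finset ℕ, (∀ v, k ≤ (L v).card) → GoodList G L by
    have : listChromNum G ≤ k := Nat.sInf_le H
    omega
  intro L hL
  choose L' hsub hcard using fun v => Finset.exists_subset_card_eq (hL v)
  by_contra hbad
  have hne : ¬ ColorableOn G Finset.univ L' := by
    rintro ⟨c, hc, hadj⟩
    exact hbad ⟨c, fun v => hsub v (hc v (Finset.mem_univ v)),
      fun u v => hadj u (Finset.mem_univ u) v (Finset.mem_univ v)⟩
  obtain ⟨W, hW, hmin⟩ := wellFounded_lt.has_min {W | ¬ ColorableOn G W L'} ⟨_, hne⟩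
  have hC : Critical G W L' k :=
    { eight_le := by omega
      card_list := hcard
      not_colorable := hW
      colorable := fun X hX => by
        by_contra h
        exact hmin X h hX
      nbr_le := fun v _ => hk ▸ card_nbr_le_maxDeg G W v
      clique_le := fun S _ hS => by
        by_contra! hlt
        obtain ⟨T, hT, hTc⟩ := Finset.exists_subset_card_eq (show maxDeg G ≤ S.card by omega)
        refine hno T ⟨fun u hu v hv huv => ?_, hTc⟩
        exact hS u (hT hu) v (hT hv) huv }
  obtain ⟨e, l, r, hM⟩ := exists_circModel hci hC (by have := hC.le_card; omega)
  exact hM.not_critical hC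
end
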